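/- arXiv:1507.01481 — 2 statements merged into one kernel-verified Lean document; each statement's English description precedes it below -/
import Mathlib

section
/- Let n ≥ 3 be an integer and let K be a convex body in ℝ² that has n-fold rotational symmetry about the origin o (so in particular o is in the interior of K). Then |K|·|K*| ≥ n²·sin²(π/n), with equality if and only if K is a regular n-gon centred at o. -/
open MeasureTheory Pointwise Real
open scoped RealInnerProductSpace

/-- Area (two-dimensional Lebesgue measure) of a subset of the plane `ℂ ≅ ℝ²`. -/
noncomputable def area (K : Set ℂ) : ℝ := (volume K).toReal

/-- The polar body `K* = {x : ⟨x,y⟩ ≤ 1 for all y ∈ K}`. -/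
def polarBody (K : Set ℂ) : Set ℂ := {x | ∀ y ∈ K, ⟪x, y⟫ ≤ 1}

/-- A convex body: a compact convex set with nonempty interior. -/
def IsConvexBody (K : Set ℂ) : Prop := Convex ℝ K ∧ IsCompact K ∧ (interior K).Nonempty

/-- The `n` equally spaced points on the circle of centre `z` determined by `z + w`. -/
noncomputable def ngonVertices (n : ℕ) (z w : ℂ) : Set ℂ :=
  Set.range fun k : Fin n => z + w * Complex.exp (2 * π * Complex.I * ((k : ℕ) : ℂ) / n)

/-- `K` is the regular `n`-gon with centre `z` whose vertices are the `n` equally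
spaced points on the circle of centre `z` through `z + w`. -/
def IsRegularNgon (n : ℕ) (z w : ℂ) (K : Set ℂ) : Prop :=
  w ≠ 0 ∧ K = convexHull ℝ (ngonVertices n z w)

/-- `K` has `n`-fold rotational symmetry about the origin: the rotation through
angle `2π/n` about `o` maps `K` onto itself. -/
def HasNFoldSymmetry (n : ℕ) (K : Set ℂ) : Prop :=
  Complex.exp (2 * π * Complex.I / n) • K = K

open scoped ComplexConjugate


/-! ### Areas of triangles -/

theorem volume_eq_lintegral_slices {S : Set ℂ} (hS : MeasurableSet S) :
    volume S = ∫⁻ a : ℝ, volume {b : ℝ | (⟨a, b⟩ : ℂ) ∈ S} := by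
  have h := Complex.volume_preserving_equiv_real_prod.symm.measure_preimage_equiv S
  rw [← h, Measure.volume_eq_prod, Measure.prod_apply
    (Complex.measurableEquivRealProd.symm.measurable hS)]
  rfl

theorem lintegral_Icc_linear {h t : ℝ} (hh : 0 ≤ h) (ht : 0 ≤ t) :
    ∫⁻ a in Set.Icc 0 h, ENNReal.ofReal (2 * (a * t)) = ENNReal.ofReal (h ^ 2 * t) := by
  rw [← ofReal_integral_eq_lintegral_ofReal]
  · rw [integral_Icc_eq_integral_Ioc, ← intervalIntegral.integral_of_le hh]
    congr 1
    rw [intervalIntegral.integral_const_mul, intervalIntegral.integral_mul_const, integral_id]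
    ring
  · exact (Continuous.integrableOn_Icc (by fun_prop))
  · filter_upwards [ae_restrict_mem measurableSet_Icc] with a ha
    have := mul_nonneg ha.1 ht
    simp only [Pi.zero_apply]
    linarith

theorem volume_closed_triangle_le {h t : ℝ} (hh : 0 ≤ h) (ht : 0 ≤ t) :
    volume {w : ℂ | w.re ≤ h ∧ |w.im| ≤ w.re * t} ≤ ENNReal.ofReal (h ^ 2 * t) := by
  have hS : IsClosed {w : ℂ | w.re ≤ h ∧ |w.im| ≤ w.re * t} :=
    (isClosed_le (f := Complex.re) (by fun_prop) (by fun_prop)).and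
      (isClosed_le (by fun_prop) (by fun_prop))
  rw [volume_eq_lintegral_slices hS.measurableSet, ← lintegral_Icc_linear hh ht,
    ← lintegral_indicator measurableSet_Icc]
  refine lintegral_mono fun a => ?_
  simp only [Set.mem_ofPred_eq]
  by_cases ha : a ∈ Set.Icc 0 h
  · rw [Set.indicator_of_mem ha]
    calc _ ≤ volume (Set.Icc (-(a * t)) (a * t)) :=
          measure_mono fun b hb => abs_le.mp hb.2
      _ = _ := by rw [Real.volume_Icc]; congr 1; ring
  · rw [Set.indicator_of_notMem ha, nonpos_iff_eq_zero]
    by_cases hah : a ≤ h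
    · have ha0 : a < 0 := by
        by_contra h0
        exact ha ⟨not_lt.mp h0, hah⟩
      refine measure_mono_null (t := {0}) (fun b hb => ?_) (by simp)
      have h1 : |b| ≤ 0 := hb.2.trans (mul_nonpos_of_nonpos_of_nonneg ha0.le ht)
      simpa using h1
    · simp [hah]

theorem one_le_volume_open_triangle :
    1 ≤ volume {w : ℂ | w.re < 1 ∧ |w.im| < w.re} := by
  have hS : IsOpen {w : ℂ | w.re < 1 ∧ |w.im| < w.re} :=
    (isOpen_lt (by fun_prop) (by fun_prop)).and (isOpen_lt (by fun_prop) (by fun_prop))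
  have h1 := lintegral_Icc_linear zero_le_one zero_le_one
  rw [← restrict_Ico_eq_restrict_Icc] at h1
  rw [volume_eq_lintegral_slices hS.measurableSet]
  calc (1 : ENNReal) = ∫⁻ a in Set.Ico (0 : ℝ) 1, ENNReal.ofReal (2 * (a * 1)) := by rw [h1]; simp
    _ ≤ _ := by
      rw [← lintegral_indicator measurableSet_Ico]
      refine lintegral_mono fun a => ?_
      by_cases ha : a ∈ Set.Ico (0 : ℝ) 1
      · rw [Set.indicator_of_mem ha]
        calc _ = volume (Set.Ioo (-a) a) := by rw [Real.volume_Ioo]; congr 1; ring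
          _ ≤ _ := measure_mono fun b hb => And.intro ha.2 (abs_lt.mpr hb)
      · rw [Set.indicator_of_notMem ha]
        exact zero_le

/-- The signed area of the parallelogram spanned by `u` and `w`. -/
def cross (u w : ℂ) : ℝ := u.re * w.im - u.im * w.re

theorem half_cross_le_volume_inter_cone {K : Set ℂ} (hK : Convex ℝ K) (h0 : 0 ∈ K) {u z : ℂ}
    (hu : u ∈ K) (hz : z ∈ K) :
    ENNReal.ofReal (cross u z / 2) ≤ volume (K ∩ {w | 0 < cross u w ∧ 0 < cross w z}) := by
  by_cases hc : cross u z ≤ 0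
  · rw [ENNReal.ofReal_of_nonpos (by linarith)]
    exact zero_le
  rw [not_le] at hc
  let A : Matrix (Fin 2) (Fin 2) ℝ :=
    !![(u.re + z.re) / 2, (z.re - u.re) / 2; (u.im + z.im) / 2, (z.im - u.im) / 2]
  let L : ℂ →ₗ[ℝ] ℂ := Matrix.toLin Complex.basisOneI Complex.basisOneI A
  have hL : ∀ w, L w = ((w.re - w.im) / 2) • u + ((w.re + w.im) / 2) • z := by
    intro w
    simp only [L, A, Matrix.toLin_apply]
    apply Complex.ext <;>
    simp [Matrix.mulVec, dotProduct, Fin.sum_univ_two] <;> ring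
  have hdet : LinearMap.det L = cross u z / 2 := by
    simp only [L, A, LinearMap.det_toLin, Matrix.det_fin_two_of, cross]
    ring
  calc ENNReal.ofReal (cross u z / 2)
      ≤ ENNReal.ofReal |LinearMap.det L| * volume {w : ℂ | w.re < 1 ∧ |w.im| < w.re} := by
        rw [hdet, abs_of_pos (by linarith)]
        exact le_mul_of_one_le_right zero_le one_le_volume_open_triangle
    _ = volume (L '' {w : ℂ | w.re < 1 ∧ |w.im| < w.re}) :=
        (Measure.addHaar_image_linearMap _ _ _).symm
    _ ≤ _ := by
        refine measure_mono ?_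
        rintro _ ⟨w, ⟨hw1, hw2⟩, rfl⟩
        rw [abs_lt] at hw2
        have hp : 0 < (w.re - w.im) / 2 := by linarith
        have hq : 0 < (w.re + w.im) / 2 := by linarith
        have e1 : cross u (L w) = (w.re + w.im) / 2 * cross u z := by
          rw [hL]; simp [cross]; ring
        have e2 : cross (L w) z = (w.re - w.im) / 2 * cross u z := by
          rw [hL]; simp [cross]; ring
        refine ⟨?_, by rw [e1]; positivity, by rw [e2]; positivity⟩
        have h3 := hK.sum_mem (t := Finset.univ)
          (w := ![1 - w.re, (w.re - w.im) / 2, (w.re + w.im) / 2]) (z := ![0, u, z])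
          (by intro i _; fin_cases i <;> simp <;> linarith)
          (by simp [Fin.sum_univ_three]; ring)
          (by intro i _; fin_cases i <;> simpa)
        rw [hL]
        simpa [Fin.sum_univ_three] using h3

theorem volume_preimage_mul_left {c : ℂ} (hc : ‖c‖ = 1) (S : Set ℂ) :
    volume {w | c * w ∈ S} = volume S := by
  let a : Circle := ⟨c, by simpa [Submonoid.unitSphere] using hc⟩
  have h := (rotation a).measurePreserving.measure_preimage_equiv
    (f := (rotation a).toMeasurableEquiv) S
  exact h

/-! ### The rotation through `2π/n` and its sectors -/

/-- The complex number whose multiplication is the rotation through `2π/n`. -/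
noncomputable def turn (n : ℕ) : ℂ := Complex.exp (2 * π * Complex.I / n)

/-- The complex number whose multiplication is the rotation through `π/n`. -/
noncomputable def halfTurn (n : ℕ) : ℂ := Complex.exp ((π / n : ℝ) * Complex.I)

theorem turn_pow (n j : ℕ) : turn n ^ j = Complex.exp ((2 * (j * (π / n)) : ℝ) * Complex.I) := by
  rw [turn, ← Complex.exp_nat_mul]
  congr 1
  push_cast
  ring

theorem turn_pow_re (n j : ℕ) : (turn n ^ j).re = cos (2 * (j * (π / n))) := by
  rw [turn_pow, Complex.exp_ofReal_mul_I_re]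

theorem turn_pow_im (n j : ℕ) : (turn n ^ j).im = sin (2 * (j * (π / n))) := by
  rw [turn_pow, Complex.exp_ofReal_mul_I_im]

theorem halfTurn_re (n : ℕ) : (halfTurn n).re = cos (π / n) := Complex.exp_ofReal_mul_I_re _

theorem halfTurn_im (n : ℕ) : (halfTurn n).im = sin (π / n) := Complex.exp_ofReal_mul_I_im _

theorem norm_halfTurn (n : ℕ) : ‖halfTurn n‖ = 1 := Complex.norm_exp_ofReal_mul_I _

theorem norm_turn_pow (n j : ℕ) : ‖turn n ^ j‖ = 1 := by
  rw [turn_pow]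
  exact Complex.norm_exp_ofReal_mul_I _

theorem turn_ne_zero (n : ℕ) : turn n ≠ 0 := Complex.exp_ne_zero _

theorem turn_eq_halfTurn_sq (n : ℕ) : turn n = halfTurn n * halfTurn n := by
  rw [turn, halfTurn, ← Complex.exp_add]
  congr 1
  push_cast
  ring

theorem isPrimitiveRoot_turn {n : ℕ} (hn : 3 ≤ n) : IsPrimitiveRoot (turn n) n :=
  Complex.isPrimitiveRoot_exp n (by lia)

theorem angle_pos {n : ℕ} (hn : 3 ≤ n) : 0 < π / n := by
  have : (0 : ℝ) < n := by exact_mod_cast (by lia : 0 < n)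
  exact div_pos pi_pos this

theorem natCast_mul_angle {n : ℕ} (hn : 3 ≤ n) : (n : ℝ) * (π / n) = π := by
  have : (n : ℝ) ≠ 0 := by exact_mod_cast (by lia : n ≠ 0)
  field_simp

theorem angle_lt {n : ℕ} (hn : 3 ≤ n) : π / n < π / 2 := by
  have h3 : (3 : ℝ) ≤ n := by exact_mod_cast hn
  exact div_lt_div_of_pos_left pi_pos (by norm_num) (by linarith)

theorem sin_angle_pos {n : ℕ} (hn : 3 ≤ n) : 0 < sin (π / n) :=
  sin_pos_of_pos_of_lt_pi (angle_pos hn) (by linarith [angle_lt hn, pi_pos])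

theorem cos_angle_pos {n : ℕ} (hn : 3 ≤ n) : 0 < cos (π / n) :=
  cos_pos_of_mem_Ioo ⟨by linarith [angle_pos hn, pi_pos], angle_lt hn⟩

theorem sin_natCast_mul_angle_nonneg {n j : ℕ} (hn : 3 ≤ n) (hj : j ≤ n) :
    0 ≤ sin (j * (π / n)) := by
  have h1 := angle_pos hn
  have hj' : (j : ℝ) ≤ n := by exact_mod_cast hj
  refine sin_nonneg_of_nonneg_of_le_pi (by positivity) ?_
  calc (j : ℝ) * (π / n) ≤ n * (π / n) := by gcongr
    _ = π := natCast_mul_angle hn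

theorem sin_natCast_mul_angle_pos {n j : ℕ} (hn : 3 ≤ n) (h0 : 0 < j) (hj : j < n) :
    0 < sin (j * (π / n)) := by
  have h1 := angle_pos hn
  have h0' : (0 : ℝ) < j := by exact_mod_cast h0
  have hj' : (j : ℝ) < n := by exact_mod_cast hj
  refine sin_pos_of_pos_of_lt_pi (by positivity) ?_
  calc (j : ℝ) * (π / n) < n * (π / n) := by gcongr
    _ = π := natCast_mul_angle hn

theorem abs_cos_mul_sin_le {n j : ℕ} (hn : 3 ≤ n) (h0 : 0 < j) (hj : j < n) :
    |cos (j * (π / n))| * sin (π / n) ≤ sin (j * (π / n)) * cos (π / n) := by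
  have h1 := sin_natCast_mul_angle_nonneg hn (show j + 1 ≤ n from hj)
  have h2 := sin_natCast_mul_angle_nonneg hn (show j - 1 ≤ n by lia)
  rw [Nat.cast_sub h0, sub_mul, Nat.cast_one, one_mul, sin_sub] at h2
  rw [Nat.cast_add, add_mul, Nat.cast_one, one_mul, sin_add] at h1
  rcases abs_cases (cos (j * (π / n))) with ⟨h, _⟩ | ⟨h, _⟩ <;> rw [h] <;> linarith

theorem re_turn_pow_mul (n j : ℕ) (w : ℂ) :
    (turn n ^ j * w).re = w.re - 2 * sin (j * (π / n)) *
      (w.re * sin (j * (π / n)) + w.im * cos (j * (π / n))) := by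
  rw [Complex.mul_re, turn_pow_re, turn_pow_im, cos_two_mul, sin_two_mul]
  linear_combination 2 * w.re * (sin_sq_add_cos_sq (j * (π / n)))

/-- The open sector of angle `2π/n` whose bisector is the positive real axis. -/
def openSector (n : ℕ) : Set ℂ := {w | |w.im| * cos (π / n) < w.re * sin (π / n)}

theorem isOpen_openSector (n : ℕ) : IsOpen (openSector n) :=
  isOpen_lt (by fun_prop) (by fun_prop)

theorem re_turn_pow_mul_lt {n j : ℕ} (hn : 3 ≤ n) (h0 : 0 < j) (hj : j < n) {w : ℂ}
    (hw : w ∈ openSector n) : (turn n ^ j * w).re < w.re := by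
  have hs := sin_natCast_mul_angle_pos hn h0 hj
  have hc := cos_angle_pos hn
  have hsφ := sin_angle_pos hn
  have hw' : |w.im| * cos (π / n) < w.re * sin (π / n) := hw
  have hab := abs_cos_mul_sin_le hn h0 hj
  have h1 : |w.im * cos (j * (π / n))| < w.re * sin (j * (π / n)) := by
    rw [abs_mul]
    have h2 : |w.im| * (|cos (j * (π / n))| * sin (π / n)) ≤
        |w.im| * (sin (j * (π / n)) * cos (π / n)) := by gcongr
    have h3 : sin (j * (π / n)) * (|w.im| * cos (π / n)) <
        sin (j * (π / n)) * (w.re * sin (π / n)) := by gcongr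
    refine lt_of_mul_lt_mul_right (a := sin (π / n)) ?_ hsφ.le
    linarith
  have h4 := neg_lt_of_abs_lt h1
  rw [re_turn_pow_mul]
  have : 0 < sin (j * (π / n)) * (w.re * sin (j * (π / n)) + w.im * cos (j * (π / n))) :=
    mul_pos hs (by linarith)
  linarith

theorem disjoint_rotated_openSector {n i j : ℕ} (hn : 3 ≤ n) (hij : i < j) (hj : j < n) {w : ℂ}
    (hi : turn n ^ i * w ∈ openSector n) : turn n ^ j * w ∉ openSector n := by
  intro h
  have e1 : turn n ^ (j - i) * (turn n ^ i * w) = turn n ^ j * w := by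
    rw [← mul_assoc, ← pow_add, Nat.sub_add_cancel hij.le]
  have e2 : turn n ^ (n - (j - i)) * (turn n ^ j * w) = turn n ^ i * w := by
    rw [← mul_assoc, ← pow_add, show n - (j - i) + j = n + i by lia, pow_add,
      (isPrimitiveRoot_turn hn).pow_eq_one, one_mul]
  have h1 := re_turn_pow_mul_lt hn (show 0 < j - i by lia) (show j - i < n by lia) hi
  have h2 := re_turn_pow_mul_lt hn (show 0 < n - (j - i) by lia) (show n - (j - i) < n by lia) h
  rw [e1] at h1
  rw [e2] at h2
  exact lt_asymm h1 h2

/-- Some rotated copy of a point lies in the closed sector around the positive real axis,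
where its real part is the largest among the rotated copies. -/
theorem exists_rotation_mem_closed_sector {n : ℕ} (hn : 3 ≤ n) (w : ℂ) :
    ∃ j < n, w.re ≤ (turn n ^ j * w).re ∧
      |(turn n ^ j * w).im| * cos (π / n) ≤ (turn n ^ j * w).re * sin (π / n) := by
  obtain ⟨j, hj, hmax⟩ := Finset.exists_max_image (Finset.range n)
    (fun j => (turn n ^ j * w).re) ⟨0, Finset.mem_range.mpr (by lia)⟩
  rw [Finset.mem_range] at hj
  have hall : ∀ i, (turn n ^ i * w).re ≤ (turn n ^ j * w).re := by
    intro i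
    rw [← pow_mod_orderOf, ← (isPrimitiveRoot_turn hn).eq_orderOf]
    exact hmax _ (Finset.mem_range.mpr (Nat.mod_lt _ (by lia)))
  refine ⟨j, hj, by simpa using hall 0, ?_⟩
  set v := turn n ^ j * w with hv
  have hs := sin_angle_pos hn
  have h1 : (turn n ^ 1 * v).re ≤ v.re := by
    rw [hv, ← mul_assoc, ← pow_add]; exact hall _
  have h2 : (turn n ^ (n - 1) * v).re ≤ v.re := by
    rw [hv, ← mul_assoc, ← pow_add]; exact hall _
  rw [re_turn_pow_mul] at h1 h2
  rw [Nat.cast_sub (by lia), sub_mul, natCast_mul_angle hn, Nat.cast_one, one_mul, sin_pi_sub,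
    cos_pi_sub] at h2
  rw [Nat.cast_one, one_mul] at h1
  have h3 : 0 ≤ v.re * sin (π / n) + v.im * cos (π / n) := by
    by_contra h; nlinarith [mul_pos_of_neg_of_neg (neg_neg_of_pos hs) (not_le.mp h)]
  have h4 : 0 ≤ v.re * sin (π / n) - v.im * cos (π / n) := by
    by_contra h; nlinarith [mul_pos_of_neg_of_neg (neg_neg_of_pos hs) (not_le.mp h)]
  rcases abs_cases v.im with ⟨h, _⟩ | ⟨h, _⟩ <;> rw [h] <;> linarith

/-! ### Area bounds for sets with `n`-fold symmetry -/

theorem turn_pow_mul_mem_iff {n : ℕ} {K : Set ℂ} (hs : ∀ w, turn n * w ∈ K ↔ w ∈ K) (j : ℕ)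
    (w : ℂ) : turn n ^ j * w ∈ K ↔ w ∈ K := by
  induction j with
  | zero => simp
  | succ j ih => rw [pow_succ', mul_assoc, hs, ih]

theorem turn_mul_mem_iff_of_forall_mem {n : ℕ} (hn : 3 ≤ n) {K : Set ℂ}
    (h : ∀ w ∈ K, turn n * w ∈ K) (w : ℂ) : turn n * w ∈ K ↔ w ∈ K := by
  have hpow : ∀ (j : ℕ), ∀ w ∈ K, turn n ^ j * w ∈ K := by
    intro j
    induction j with
    | zero => simp
    | succ j ih =>
      intro w hw
      rw [pow_succ', mul_assoc]
      exact h _ (ih w hw)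
  refine ⟨fun hw => ?_, h w⟩
  have := hpow (n - 1) _ hw
  rwa [← mul_assoc, ← pow_succ, Nat.sub_add_cancel (by lia),
    (isPrimitiveRoot_turn hn).pow_eq_one, one_mul] at this

theorem zero_mem_of_turn_symmetric {n : ℕ} (hn : 3 ≤ n) {K : Set ℂ} (hK : Convex ℝ K)
    (hs : ∀ w, turn n * w ∈ K ↔ w ∈ K) {x : ℂ} (hx : x ∈ K) : (0 : ℂ) ∈ K := by
  have hn0 : (n : ℝ) ≠ 0 := by exact_mod_cast (by lia : n ≠ 0)
  have h := hK.sum_mem (t := Finset.range n) (w := fun _ => (n : ℝ)⁻¹)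
    (z := fun j => turn n ^ j * x) (fun _ _ => by positivity) (by simp [hn0])
    (fun j _ => (turn_pow_mul_mem_iff hs j x).mpr hx)
  rwa [← Finset.smul_sum, ← Finset.sum_mul,
    (isPrimitiveRoot_turn hn).geom_sum_eq_zero (by lia), zero_mul, smul_zero] at h

theorem natCast_mul_volume_inter_sector_le {n : ℕ} (hn : 3 ≤ n) {K : Set ℂ}
    (hm : MeasurableSet K) (hs : ∀ w, turn n * w ∈ K ↔ w ∈ K) (m : ℂ) :
    n * volume (K ∩ {w | m * w ∈ openSector n}) ≤ volume K := by
  let S : ℕ → Set ℂ := fun j => {w | turn n ^ j * w ∈ K ∩ {w | m * w ∈ openSector n}}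
  have hSvol : ∀ j, volume (S j) = volume (K ∩ {w | m * w ∈ openSector n}) :=
    fun j => volume_preimage_mul_left (norm_turn_pow n j) _
  have hcomm : ∀ j w, m * (turn n ^ j * w) = turn n ^ j * (m * w) := fun j w => by ring
  have hdisj : ∀ i j, i < j → j < n → Disjoint (S i) (S j) := by
    intro i j hij hj
    rw [Set.disjoint_left]
    rintro w ⟨-, h1⟩ ⟨-, h2⟩
    simp only [Set.mem_ofPred_eq, hcomm] at h1 h2
    exact disjoint_rotated_openSector hn hij hj h1 h2
  have hmeas : ∀ j ∈ Finset.range n, MeasurableSet (S j) := by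
    intro j _
    have hopen : MeasurableSet {w | m * w ∈ openSector n} :=
      ((isOpen_openSector n).preimage (continuous_const_mul m)).measurableSet
    exact (measurable_const_mul (turn n ^ j)) (hm.inter hopen)
  have hsum := measure_biUnion_finset (μ := volume) (s := Finset.range n) (f := S) (by
    intro i hi j hj hij
    simp only [Finset.coe_range, Set.mem_Iio] at hi hj
    rcases lt_or_gt_of_ne hij with h | h
    · exact hdisj i j h hj
    · exact (hdisj j i h hi).symm) hmeas
  simp only [hSvol, Finset.sum_const, Finset.card_range, nsmul_eq_mul] at hsum
  rw [← hsum]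
  refine measure_mono (Set.iUnion₂_subset fun j _ w hw => ?_)
  exact (turn_pow_mul_mem_iff hs j w).mp hw.1

theorem cross_eq (n : ℕ) (x w : ℂ) :
    cross x w = (conj (halfTurn n * x) * w).im * cos (π / n) +
      (conj (halfTurn n * x) * w).re * sin (π / n) := by
  have h := sin_sq_add_cos_sq (π / n)
  simp only [cross, map_mul, Complex.mul_re, Complex.mul_im, Complex.conj_re, Complex.conj_im,
    halfTurn_re, halfTurn_im]
  linear_combination (-(x.re * w.im - x.im * w.re)) * h

theorem cross_turn_mul_eq (n : ℕ) (x w : ℂ) :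
    cross w (turn n * x) = (conj (halfTurn n * x) * w).re * sin (π / n) -
      (conj (halfTurn n * x) * w).im * cos (π / n) := by
  rw [turn_eq_halfTurn_sq]
  simp only [cross, map_mul, Complex.mul_re, Complex.mul_im, Complex.conj_re, Complex.conj_im,
    halfTurn_re, halfTurn_im]
  ring

theorem mem_openSector_of_cross_pos {n : ℕ} {x w : ℂ} (h1 : 0 < cross x w)
    (h2 : 0 < cross w (turn n * x)) : conj (halfTurn n * x) * w ∈ openSector n := by
  rw [cross_eq n] at h1
  rw [cross_turn_mul_eq] at h2
  rw [openSector, Set.mem_ofPred_eq]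
  rcases abs_cases (conj (halfTurn n * x) * w).im with ⟨h, _⟩ | ⟨h, _⟩ <;> rw [h] <;> linarith

/-- The area of a convex set with `n`-fold symmetry is at least the area of the `2n`-gon spanned
by the orbits of two of its points. -/
theorem inner_le_area {n : ℕ} (hn : 3 ≤ n) {K : Set ℂ} (hK : Convex ℝ K) (hc : IsCompact K)
    (hs : ∀ w, turn n * w ∈ K ↔ w ∈ K) {x z : ℂ} (hx : x ∈ K) (hz : z ∈ K) :
    n * sin (π / n) * ⟪halfTurn n * x, z⟫ ≤ area K := by
  have h0 := zero_mem_of_turn_symmetric hn hK hs hx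
  by_cases hx0 : x = 0
  · simp [hx0, area]
  obtain ⟨j, hj, hre, hsec⟩ := exists_rotation_mem_closed_sector hn (conj (halfTurn n * x) * z)
  set z' := turn n ^ j * z with hz'
  have hz'K : z' ∈ K := (turn_pow_mul_mem_iff hs j z).mpr hz
  have hmz' : turn n ^ j * (conj (halfTurn n * x) * z) = conj (halfTurn n * x) * z' := by
    rw [hz']; ring
  rw [hmz'] at hre hsec
  have hsφ := sin_angle_pos hn
  have hxz : 0 ≤ cross x z' := by
    rw [cross_eq n]
    rcases abs_cases (conj (halfTurn n * x) * z').im with ⟨h, _⟩ | ⟨h, _⟩ <;> rw [h] at hsec <;>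
      nlinarith [cos_angle_pos hn]
  have hzx : 0 ≤ cross z' (turn n * x) := by
    rw [cross_turn_mul_eq n]
    rcases abs_cases (conj (halfTurn n * x) * z').im with ⟨h, _⟩ | ⟨h, _⟩ <;> rw [h] at hsec <;>
      nlinarith [cos_angle_pos hn]
  have hxx : 0 < cross x (turn n * x) := by
    rw [cross_turn_mul_eq n]
    have := cos_angle_pos hn
    have hx2 := Complex.normSq_pos.mpr hx0
    rw [Complex.normSq_apply] at hx2
    simp only [map_mul, Complex.mul_re, Complex.mul_im, Complex.conj_re, Complex.conj_im,
      halfTurn_re, halfTurn_im]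
    have : 0 < 2 * cos (π / n) * sin (π / n) * (x.re * x.re + x.im * x.im) := by positivity
    linarith
  have pluecker : ∀ w, cross x z' * cross w (turn n * x) =
      cross x w * cross z' (turn n * x) + cross x (turn n * x) * cross w z' := by
    intro w; simp only [cross]; ring
  have pluecker' : ∀ w, cross z' (turn n * x) * cross x w =
      cross x z' * cross w (turn n * x) + cross x (turn n * x) * cross z' w := by
    intro w; simp only [cross]; ring
  let D₁ : Set ℂ := {w | 0 < cross x w ∧ 0 < cross w z'}
  let D₂ : Set ℂ := {w | 0 < cross z' w ∧ 0 < cross w (turn n * x)}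
  have hD₁ : K ∩ D₁ ⊆ K ∩ {w | conj (halfTurn n * x) * w ∈ openSector n} := by
    rintro w ⟨hwK, h1, h2⟩
    refine ⟨hwK, mem_openSector_of_cross_pos h1 ?_⟩
    by_contra hneg
    have := mul_nonpos_of_nonneg_of_nonpos hxz (not_lt.mp hneg)
    linarith [pluecker w, mul_nonneg h1.le hzx, mul_pos hxx h2]
  have hD₂ : K ∩ D₂ ⊆ K ∩ {w | conj (halfTurn n * x) * w ∈ openSector n} := by
    rintro w ⟨hwK, h1, h2⟩
    refine ⟨hwK, mem_openSector_of_cross_pos ?_ h2⟩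
    by_contra hneg
    have := mul_nonpos_of_nonneg_of_nonpos hzx (not_lt.mp hneg)
    linarith [pluecker' w, mul_nonneg hxz h2.le, mul_pos hxx h1]
  have hdisj : Disjoint (K ∩ D₁) (K ∩ D₂) := by
    rw [Set.disjoint_left]
    rintro w ⟨-, -, h1⟩ ⟨-, h2, -⟩
    simp only [cross] at h1 h2
    linarith
  have hmD₂ : MeasurableSet D₂ := by
    have : IsOpen D₂ :=
      (isOpen_lt continuous_const (by unfold cross; fun_prop)).and
        (isOpen_lt continuous_const (by unfold cross; fun_prop))
    exact this.measurableSet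
  have hkey : n * ENNReal.ofReal (sin (π / n) * (conj (halfTurn n * x) * z').re) ≤ volume K := by
    refine le_trans ?_ (natCast_mul_volume_inter_sector_le hn hc.measurableSet hs
      (conj (halfTurn n * x)))
    gcongr
    calc _ = ENNReal.ofReal (cross x z' / 2) + ENNReal.ofReal (cross z' (turn n * x) / 2) := by
          rw [← ENNReal.ofReal_add (by linarith) (by linarith), cross_eq n, cross_turn_mul_eq]
          congr 1
          ring
      _ ≤ volume (K ∩ D₁) + volume (K ∩ D₂) :=
          add_le_add (half_cross_le_volume_inter_cone hK h0 hx hz'K)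
            (half_cross_le_volume_inter_cone hK h0 hz'K ((hs x).mpr hx))
      _ = volume (K ∩ D₁ ∪ K ∩ D₂) := (measure_union hdisj (hc.measurableSet.inter hmD₂)).symm
      _ ≤ _ := measure_mono (Set.union_subset hD₁ hD₂)
  rw [← ENNReal.ofReal_natCast, ← ENNReal.ofReal_mul (by positivity),
    ENNReal.ofReal_le_iff_le_toReal hc.measure_lt_top.ne] at hkey
  calc _ = n * (sin (π / n) * (conj (halfTurn n * x) * z).re) := by
        rw [Complex.inner, mul_comm z]; ring
    _ ≤ n * (sin (π / n) * (conj (halfTurn n * x) * z').re) := by gcongr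
    _ ≤ _ := hkey

/-- The area of a set with `n`-fold symmetry that lies in a half-plane is at most the area of the
regular `n`-gon with the corresponding inradius. -/
theorem area_le_of_inner_le {n : ℕ} (hn : 3 ≤ n) {K : Set ℂ}
    (hs : ∀ w, turn n * w ∈ K ↔ w ∈ K) {q : ℂ} (hq : ‖q‖ = 1) {h : ℝ} (hh : 0 ≤ h)
    (hle : ∀ w ∈ K, ⟪q, w⟫ ≤ h) :
    area K ≤ n * (h ^ 2 * (sin (π / n) / cos (π / n))) := by
  have hcφ := cos_angle_pos hn
  have hsφ := sin_angle_pos hn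
  let T : Set ℂ := {w : ℂ | w.re ≤ h ∧ |w.im| ≤ w.re * (sin (π / n) / cos (π / n))}
  have hcover : K ⊆ ⋃ j ∈ Finset.range n, {w | (turn n ^ j * conj q) * w ∈ T} := by
    intro w hw
    obtain ⟨j, hj, -, hsec⟩ := exists_rotation_mem_closed_sector hn (conj q * w)
    rw [← mul_assoc] at hsec
    refine Set.mem_iUnion₂.mpr ⟨j, Finset.mem_range.mpr hj, And.intro ?_ ?_⟩
    · have := hle _ ((turn_pow_mul_mem_iff hs j w).mpr hw)
      rw [Complex.inner] at this
      convert this using 2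
      ring
    · rw [mul_div_assoc', le_div_iff₀ hcφ]
      exact hsec
  have hvol : volume K ≤ ENNReal.ofReal (n * (h ^ 2 * (sin (π / n) / cos (π / n)))) := by
    refine (measure_mono hcover).trans ((measure_biUnion_finset_le _ _).trans ?_)
    have : ∀ j, volume {w | (turn n ^ j * conj q) * w ∈ T} = volume T := fun j =>
      volume_preimage_mul_left (by rw [norm_mul, norm_turn_pow, RCLike.norm_conj, hq, one_mul]) _
    simp only [this, Finset.sum_const, Finset.card_range, nsmul_eq_mul]
    rw [ENNReal.ofReal_mul (by positivity), ENNReal.ofReal_natCast]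
    gcongr
    exact volume_closed_triangle_le hh (by positivity)
  exact ENNReal.toReal_le_of_le_ofReal (by positivity) hvol

/-! ### Polar bodies -/

theorem isCompact_polarBody {K : Set ℂ} (ho : (0 : ℂ) ∈ interior K) :
    IsCompact (polarBody K) := by
  have hclosed : IsClosed (polarBody K) := by
    have : polarBody K = ⋂ y ∈ K, {x | ⟪x, y⟫ ≤ 1} := by
      ext x
      simp [polarBody]
    rw [this]
    exact isClosed_biInter fun y _ => isClosed_le (by fun_prop) continuous_const
  obtain ⟨r, hr, hball⟩ := Metric.mem_nhds_iff.mp (mem_interior_iff_mem_nhds.mp ho)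
  refine Metric.isCompact_of_isClosed_isBounded hclosed
    ((Metric.isBounded_closedBall (x := (0 : ℂ)) (r := 2 / r)).subset fun w hw => ?_)
  rw [mem_closedBall_zero_iff]
  rcases eq_or_ne w 0 with rfl | hw0
  · simp only [norm_zero]; positivity
  have hpos : 0 < ‖w‖ := norm_pos_iff.mpr hw0
  have h := hw ((r / 2 / ‖w‖) • w) (hball (by
    rw [mem_ball_zero_iff, norm_smul, Real.norm_of_nonneg (by positivity)]
    field_simp
    linarith))
  rw [real_inner_smul_right, real_inner_self_eq_norm_sq] at h
  rw [le_div_iff₀ hr]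
  field_simp at h
  linarith

theorem convex_polarBody (K : Set ℂ) : Convex ℝ (polarBody K) := by
  intro x hx y hy a b ha hb hab z hz
  rw [inner_add_left, real_inner_smul_left, real_inner_smul_left]
  have h1 := mul_le_mul_of_nonneg_left (hx z hz) ha
  have h2 := mul_le_mul_of_nonneg_left (hy z hz) hb
  linarith

theorem inner_mul_mul_of_norm_eq_one {c : ℂ} (hc : ‖c‖ = 1) (x y : ℂ) :
    ⟪c * x, c * y⟫ = ⟪x, y⟫ := by
  have h : c * conj c = 1 := by rw [Complex.mul_conj']; simp [hc]
  rw [Complex.inner, Complex.inner, map_mul]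
  congr 1
  linear_combination (y * conj x) * h

theorem norm_turn (n : ℕ) : ‖turn n‖ = 1 := by simpa using norm_turn_pow n 1

theorem turn_mul_mem_polarBody_iff {n : ℕ} (hn : 3 ≤ n) {K : Set ℂ}
    (hs : ∀ w, turn n * w ∈ K ↔ w ∈ K) (w : ℂ) :
    turn n * w ∈ polarBody K ↔ w ∈ polarBody K := by
  refine turn_mul_mem_iff_of_forall_mem (K := polarBody K) hn (fun w hw y hy => ?_) w
  have h := hw ((turn n)⁻¹ * y) ((hs _).mp (by rwa [mul_inv_cancel_left₀ (turn_ne_zero n)]))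
  rwa [← inner_mul_mul_of_norm_eq_one (norm_turn n),
    mul_inv_cancel_left₀ (turn_ne_zero n)] at h

/-- The support function of `K` in the direction orthogonal to the chord from `x` to its image
under the rotation bounds the area of the polar body, provided `x` is a contact point. -/
theorem le_mul_area_polarBody {n : ℕ} (hn : 3 ≤ n) {K : Set ℂ} (ho : (0 : ℂ) ∈ interior K)
    (hs : ∀ w, turn n * w ∈ K ↔ w ∈ K) {x y : ℂ} (hy : y ∈ polarBody K) (hxy : ⟪y, x⟫ = 1)
    {M : ℝ} (hM : 0 < M) (hle : ∀ z ∈ K, ⟪halfTurn n * x, z⟫ ≤ M) :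
    n * sin (π / n) ≤ M * area (polarBody K) := by
  have hp : M⁻¹ • (halfTurn n * x) ∈ polarBody K := by
    intro z hz
    rw [real_inner_smul_left, inv_mul_le_iff₀ hM, mul_one]
    exact hle z hz
  have h := inner_le_area hn (convex_polarBody K) (isCompact_polarBody ho)
    (turn_mul_mem_polarBody_iff hn hs) hy hp
  rw [real_inner_smul_right, inner_mul_mul_of_norm_eq_one (norm_halfTurn n), hxy] at h
  calc (n : ℝ) * sin (π / n) = M * (n * sin (π / n) * (M⁻¹ * 1)) := by field_simp
    _ ≤ _ := by gcongr

theorem exists_pos_add_smul_mem {K : Set ℂ} {w : ℂ} (hw : w ∈ interior K) (v : ℂ) :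
    ∃ ε : ℝ, 0 < ε ∧ w + ε • v ∈ K := by
  have hcont : Filter.Tendsto (fun s : ℝ => w + s • v) (nhds 0) (nhds w) := by
    have : Continuous fun s : ℝ => w + s • v := by fun_prop
    simpa using this.tendsto 0
  have h : ∀ᶠ s in nhdsWithin (0 : ℝ) (Set.Ioi 0), w + s • v ∈ K :=
    (hcont.eventually (mem_interior_iff_mem_nhds.mp hw)).filter_mono nhdsWithin_le_nhds
  obtain ⟨s, h1, h2⟩ := (h.and self_mem_nhdsWithin).exists
  exact ⟨s, h2, h1⟩

theorem exists_polarBody_contact {K : Set ℂ} (hK : Convex ℝ K) (ho : (0 : ℂ) ∈ interior K)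
    {x : ℂ} (hx : x ∉ interior K) : ∃ y ∈ polarBody K, ⟪y, x⟫ = 1 := by
  obtain ⟨f, hf⟩ := geometric_hahn_banach_open_point hK.interior isOpen_interior hx
  have hfx : 0 < f x := by simpa using hf 0 ho
  have hfK : ∀ z ∈ K, f z ≤ f x := by
    intro z hz
    have hz' : z ∈ closure (interior K) := by
      rw [hK.closure_interior_eq_closure_of_nonempty_interior ⟨0, ho⟩]
      exact subset_closure hz
    exact closure_minimal (fun a ha => (hf a ha).le)
      (isClosed_le f.continuous continuous_const) hz'
  have hinner : ∀ z, ⟪(f x)⁻¹ • (InnerProductSpace.toDual ℝ ℂ).symm f, z⟫ = (f x)⁻¹ * f z := by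
    intro z
    rw [real_inner_smul_left, InnerProductSpace.toDual_symm_apply]
  refine ⟨_, fun z hz => ?_, (hinner x).trans (inv_mul_cancel₀ hfx.ne')⟩
  rw [hinner, inv_mul_le_iff₀ hfx, mul_one]
  exact hfK z hz

/-- The ray through `u` leaves `K` at a contact point. -/
theorem exists_smul_contact {K : Set ℂ} (hK : Convex ℝ K) (hc : IsCompact K)
    (ho : (0 : ℂ) ∈ interior K) {u : ℂ} (hu : u ≠ 0) :
    ∃ t : ℝ, 0 < t ∧ t • u ∈ K ∧ ∃ y ∈ polarBody K, ⟪y, t • u⟫ = 1 := by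
  have hu2 : 0 < ⟪u, u⟫ := real_inner_self_pos.mpr hu
  obtain ⟨x, ⟨hxK, hxu⟩, hmax⟩ := (hc.inter_right
    (Submodule.closed_of_finiteDimensional (Submodule.span ℝ {u}))).exists_isMaxOn
      ⟨0, interior_subset ho, Submodule.zero_mem _⟩
      (f := fun w => ⟪u, w⟫) (by fun_prop)
  obtain ⟨t, rfl⟩ := Submodule.mem_span_singleton.mp hxu
  have hle : ∀ s : ℝ, s • u ∈ K → s ≤ t := by
    intro s hs
    have h : ⟪u, s • u⟫ ≤ ⟪u, t • u⟫ :=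
      hmax ⟨hs, Submodule.smul_mem _ _ (Submodule.mem_span_singleton_self u)⟩
    rw [real_inner_smul_right, real_inner_smul_right] at h
    exact le_of_mul_le_mul_right h hu2
  obtain ⟨ε, hε, hεK⟩ := exists_pos_add_smul_mem ho u
  rw [zero_add] at hεK
  refine ⟨t, hε.trans_le (hle ε hεK), hxK, exists_polarBody_contact hK ho fun hint => ?_⟩
  obtain ⟨δ, hδ, hδK⟩ := exists_pos_add_smul_mem hint u
  rw [← add_smul] at hδK
  linarith [hle _ hδK]

theorem area_pos {K : Set ℂ} (hc : IsCompact K) (ho : (0 : ℂ) ∈ interior K) : 0 < area K :=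
  ENNReal.toReal_pos
    (((isOpen_interior.measure_pos volume ⟨0, ho⟩).trans_le (measure_mono interior_subset)).ne')
    hc.measure_lt_top.ne

theorem le_area_mul_area_polarBody {n : ℕ} (hn : 3 ≤ n) {K : Set ℂ} (hK : Convex ℝ K)
    (hc : IsCompact K) (ho : (0 : ℂ) ∈ interior K) (hs : ∀ w, turn n * w ∈ K ↔ w ∈ K) :
    (n : ℝ) ^ 2 * sin (π / n) ^ 2 ≤ area K * area (polarBody K) := by
  obtain ⟨t, -, hx, y, hy, hxy⟩ := exists_smul_contact hK hc ho one_ne_zero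
  have hA := area_pos hc ho
  have hns : 0 < n * sin (π / n) :=
    mul_pos (by exact_mod_cast (by lia : 0 < n)) (sin_angle_pos hn)
  have h := le_mul_area_polarBody hn ho hs hy hxy (div_pos hA hns) fun z hz => by
    rw [le_div_iff₀' hns]
    exact inner_le_area hn hK hc hs hx hz
  rw [div_mul_eq_mul_div, le_div_iff₀ hns] at h
  linarith

/-! ### Polygons spanned by orbits -/

theorem pow_eq_pow_iff_exists_turn {n : ℕ} (hn : 3 ≤ n) {v w : ℂ} :
    v ^ n = w ^ n ↔ ∃ j < n, v = turn n ^ j * w := by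
  have hn0 : n ≠ 0 := by lia
  have : NeZero n := ⟨hn0⟩
  constructor
  · intro h
    rcases eq_or_ne w 0 with rfl | hw
    · exact ⟨0, by lia, by simpa [hn0] using h⟩
    · obtain ⟨j, hj, hjv⟩ := (isPrimitiveRoot_turn hn).eq_pow_of_pow_eq_one
        (ξ := v / w) (by rw [div_pow, h, div_self (pow_ne_zero n hw)])
      exact ⟨j, hj, by rw [hjv, div_mul_cancel₀ _ hw]⟩
  · rintro ⟨j, -, rfl⟩
    rw [mul_pow, ← pow_mul, mul_comm j, pow_mul, (isPrimitiveRoot_turn hn).pow_eq_one, one_pow,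
      one_mul]

theorem ngonVertices_zero_eq {n : ℕ} (hn : 3 ≤ n) (w : ℂ) :
    ngonVertices n 0 w = {v | v ^ n = w ^ n} := by
  have hexp : ∀ k : ℕ,
      0 + w * Complex.exp (2 * π * Complex.I * (k : ℂ) / n) = turn n ^ k * w := by
    intro k
    rw [turn, ← Complex.exp_nat_mul, zero_add, mul_comm w]
    congr 2
    ring
  ext v
  rw [Set.mem_ofPred_eq, pow_eq_pow_iff_exists_turn hn]
  constructor
  · rintro ⟨k, rfl⟩
    exact ⟨k, k.2, hexp k⟩
  · rintro ⟨j, hj, rfl⟩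
    exact ⟨⟨j, hj⟩, hexp j⟩

theorem finite_setOf_pow_eq {n : ℕ} (hn : 3 ≤ n) (w : ℂ) : {v : ℂ | v ^ n = w ^ n}.Finite := by
  refine ((Finset.range n).finite_toSet.image fun j => turn n ^ j * w).subset fun v hv => ?_
  obtain ⟨j, hj, rfl⟩ := (pow_eq_pow_iff_exists_turn hn).mp hv
  exact ⟨j, Finset.mem_coe.mpr (Finset.mem_range.mpr hj), rfl⟩

theorem setOf_pow_eq_subset {n : ℕ} (hn : 3 ≤ n) {K : Set ℂ}
    (hs : ∀ w, turn n * w ∈ K ↔ w ∈ K) {x : ℂ} (hx : x ∈ K) : {v : ℂ | v ^ n = x ^ n} ⊆ K := by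
  intro v hv
  obtain ⟨j, -, rfl⟩ := (pow_eq_pow_iff_exists_turn hn).mp hv
  exact (turn_pow_mul_mem_iff hs j x).mpr hx

theorem turn_mul_mem_convexHull_iff {n : ℕ} (hn : 3 ≤ n) {S : Set ℂ}
    (hS : ∀ w ∈ S, turn n * w ∈ S) (w : ℂ) :
    turn n * w ∈ convexHull ℝ S ↔ w ∈ convexHull ℝ S := by
  refine turn_mul_mem_iff_of_forall_mem hn (fun v hv => ?_) w
  have h : LinearMap.mulLeft ℝ (turn n) v ∈
      convexHull ℝ (LinearMap.mulLeft ℝ (turn n) '' S) := by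
    rw [← LinearMap.image_convexHull]
    exact ⟨v, hv, rfl⟩
  refine convexHull_mono ?_ h
  rintro _ ⟨s, hs, rfl⟩
  exact hS s hs

theorem subset_of_area_le {P K : Set ℂ} (hP : IsCompact P) (hPK : P ⊆ K) (hK : Convex ℝ K)
    (hc : IsCompact K) (ho : (interior K).Nonempty) (h : area K ≤ area P) : K ⊆ P := by
  have hint : interior K ⊆ P := by
    by_contra hnot
    obtain ⟨w, hw, hwP⟩ := Set.not_subset.mp hnot
    have hpos : 0 < volume (interior K \ P) :=
      (isOpen_interior.sdiff hP.isClosed).measure_pos volume ⟨w, hw, hwP⟩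
    have hsum : volume P + volume (interior K \ P) ≤ volume K := by
      rw [← measure_union' Set.disjoint_sdiff_right hP.measurableSet]
      exact measure_mono (Set.union_subset hPK (Set.sdiff_subset.trans interior_subset))
    have hle : volume K ≤ volume P :=
      (ENNReal.toReal_le_toReal hc.measure_lt_top.ne hP.measure_lt_top.ne).mp h
    have := ENNReal.lt_add_right (hP.measure_lt_top (μ := volume)).ne hpos.ne'
    exact absurd (hsum.trans hle) (not_le.mpr this)
  calc K ⊆ closure K := subset_closure
    _ = closure (interior K) := (hK.closure_interior_eq_closure_of_nonempty_interior ho).symm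
    _ ⊆ P := closure_minimal hint hP.isClosed

/-- In the equality case, the orbit of any contact point, together with the orbit of one further
point, contains all extreme points. -/
theorem exists_extremePoints_subset_of_area_mul_eq {n : ℕ} (hn : 3 ≤ n) {K : Set ℂ}
    (hK : Convex ℝ K) (hc : IsCompact K) (ho : (0 : ℂ) ∈ interior K)
    (hs : ∀ w, turn n * w ∈ K ↔ w ∈ K)
    (heq : area K * area (polarBody K) = (n : ℝ) ^ 2 * sin (π / n) ^ 2)
    {x y : ℂ} (hx : x ∈ K) (hy : y ∈ polarBody K) (hxy : ⟪y, x⟫ = 1) :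
    ∃ z ∈ K, z ≠ 0 ∧ K.extremePoints ℝ ⊆ {v | v ^ n = x ^ n} ∪ {v | v ^ n = z ^ n} := by
  have hns : 0 < n * sin (π / n) :=
    mul_pos (by exact_mod_cast (by lia : 0 < n)) (sin_angle_pos hn)
  have hA := area_pos hc ho
  have hA' : 0 < area (polarBody K) :=
    pos_of_mul_pos_right (by rw [heq, ← mul_pow]; positivity) hA.le
  have hx0 : x ≠ 0 := by
    rintro rfl
    simp at hxy
  obtain ⟨z, hzK, hmax⟩ := hc.exists_isMaxOn ⟨x, hx⟩
    (f := fun w => ⟪halfTurn n * x, w⟫) (by fun_prop)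
  have hzpos : 0 < ⟪halfTurn n * x, z⟫ := by
    obtain ⟨ε, hε, hεK⟩ := exists_pos_add_smul_mem ho (halfTurn n * x)
    refine lt_of_lt_of_le ?_ (hmax hεK)
    simp only [zero_add, real_inner_smul_right]
    exact mul_pos hε (real_inner_self_pos.mpr (mul_ne_zero (Complex.exp_ne_zero _) hx0))
  have hle := le_mul_area_polarBody hn ho hs hy hxy hzpos fun w hw => hmax hw
  have hAz : area K ≤ n * sin (π / n) * ⟪halfTurn n * x, z⟫ := by
    refine le_of_mul_le_mul_right ?_ hA'
    rw [heq, ← mul_pow, sq, mul_assoc _ ⟪halfTurn n * x, z⟫]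
    exact mul_le_mul_of_nonneg_left hle hns.le
  set S : Set ℂ := {v | v ^ n = x ^ n} ∪ {v | v ^ n = z ^ n} with hS
  have hSfin : S.Finite := (finite_setOf_pow_eq hn x).union (finite_setOf_pow_eq hn z)
  have hPK : convexHull ℝ S ⊆ K := convexHull_min
    (Set.union_subset (setOf_pow_eq_subset hn hs hx) (setOf_pow_eq_subset hn hs hzK)) hK
  have hPs := turn_mul_mem_convexHull_iff hn (S := S) fun w hw => by
    rw [hS, Set.mem_union, Set.mem_ofPred_eq, Set.mem_ofPred_eq, mul_pow,
      (isPrimitiveRoot_turn hn).pow_eq_one, one_mul]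
    exact hw
  have hP := hSfin.isCompact_convexHull (𝕜 := ℝ)
  have hKP : K ⊆ convexHull ℝ S := subset_of_area_le hP hPK hK hc ⟨0, ho⟩
    (hAz.trans (inner_le_area hn (convex_convexHull ℝ S) hP hPs
      (subset_convexHull ℝ S (Or.inl rfl)) (subset_convexHull ℝ S (Or.inr rfl))))
  refine ⟨z, hzK, ?_, ?_⟩
  · rintro rfl
    simp at hzpos
  · rw [hKP.antisymm hPK]
    exact extremePoints_convexHull_subset

theorem exists_isRegularNgon_of_area_mul_eq {n : ℕ} (hn : 3 ≤ n) {K : Set ℂ}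
    (hK : Convex ℝ K) (hc : IsCompact K) (ho : (0 : ℂ) ∈ interior K)
    (hs : ∀ w, turn n * w ∈ K ↔ w ∈ K)
    (heq : area K * area (polarBody K) = (n : ℝ) ^ 2 * sin (π / n) ^ 2) :
    ∃ w : ℂ, IsRegularNgon n 0 w K := by
  obtain ⟨t₀, -, hx₀, y₀, hy₀, hxy₀⟩ := exists_smul_contact hK hc ho one_ne_zero
  obtain ⟨z₀, -, -, hext₀⟩ :=
    exists_extremePoints_subset_of_area_mul_eq hn hK hc ho hs heq hx₀ hy₀ hxy₀
  set x₀ := t₀ • (1 : ℂ)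
  set E : Set ℂ := {v | v ^ n = x₀ ^ n} ∪ {v | v ^ n = z₀ ^ n}
  have hEfin : E.Finite := (finite_setOf_pow_eq hn x₀).union (finite_setOf_pow_eq hn z₀)
  obtain ⟨u, hu⟩ : ∃ u : ℂ, ∀ e ∈ E, u ∉ Submodule.span ℝ {e} := by
    have h := Subspace.biUnion_ne_univ_of_top_notMem
      (s := hEfin.toFinset.image fun e => Submodule.span ℝ {e}) (by
        rw [Finset.mem_image]
        rintro ⟨e, -, he⟩
        have h1 := finrank_span_le_card (R := ℝ) ({e} : Set ℂ)
        rw [he, finrank_top, Complex.finrank_real_complex] at h1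
        simp at h1)
    obtain ⟨u, hu⟩ := (Set.ne_univ_iff_exists_notMem _).mp h
    refine ⟨u, fun e he hue => hu ?_⟩
    simp only [Finset.mem_image, Set.Finite.mem_toFinset, Set.mem_iUnion]
    exact ⟨_, ⟨e, he, rfl⟩, hue⟩
  have hu0 : u ≠ 0 := by
    rintro rfl
    exact hu x₀ (Or.inl rfl) (Submodule.zero_mem _)
  obtain ⟨t, ht, hx, y, hy, hxy⟩ := exists_smul_contact hK hc ho hu0
  obtain ⟨z, hzK, hz0, hext⟩ :=
    exists_extremePoints_subset_of_area_mul_eq hn hK hc ho hs heq hx hy hxy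
  have hxE : t • u ∉ E := fun h => hu _ h (Submodule.mem_span_singleton.mpr
    ⟨t⁻¹, inv_smul_smul₀ ht.ne' u⟩)
  have hsub : K.extremePoints ℝ ⊆ {v | v ^ n = z ^ n} := by
    intro e he
    refine (hext he).resolve_left fun hex => hxE ?_
    exact (hext₀ he).imp (fun h => Eq.trans (Eq.symm hex) h) fun h => Eq.trans (Eq.symm hex) h
  refine ⟨z, hz0, ?_⟩
  rw [ngonVertices_zero_eq hn]
  refine Set.Subset.antisymm ?_ (convexHull_min (setOf_pow_eq_subset hn hs hzK) hK)
  rw [← closure_convexHull_extremePoints hc hK]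
  exact closure_minimal (convexHull_mono hsub) ((finite_setOf_pow_eq hn z).isClosed_convexHull ℝ)

theorem area_mul_area_polarBody_le_of_isRegularNgon {n : ℕ} (hn : 3 ≤ n) {K : Set ℂ}
    (hs : ∀ w, turn n * w ∈ K ↔ w ∈ K) {w : ℂ} (hw : IsRegularNgon n 0 w K) :
    area K * area (polarBody K) ≤ (n : ℝ) ^ 2 * sin (π / n) ^ 2 := by
  obtain ⟨hw0, hKw⟩ := hw
  rw [ngonVertices_zero_eq hn] at hKw
  have hr : 0 < ‖w‖ := norm_pos_iff.mpr hw0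
  have hcφ := cos_angle_pos hn
  have hsφ := sin_angle_pos hn
  have hwK : w ∈ K := by
    rw [hKw]
    exact subset_convexHull ℝ _ rfl
  have h1 : area K ≤ n * ((‖w‖ * cos (π / n)) ^ 2 * (sin (π / n) / cos (π / n))) := by
    refine area_le_of_inner_le hn hs (q := ‖w‖⁻¹ • (halfTurn n * w)) ?_ (by positivity) ?_
    · rw [norm_smul, norm_mul, norm_halfTurn, one_mul, norm_inv, norm_norm,
        inv_mul_cancel₀ hr.ne']
    · have hhalf : Convex ℝ {v | ⟪‖w‖⁻¹ • (halfTurn n * w), v⟫ ≤ ‖w‖ * cos (π / n)} :=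
        convex_halfSpace_le (innerₗ ℂ (‖w‖⁻¹ • (halfTurn n * w))).isLinear _
      rw [hKw]
      refine fun v hv => convexHull_min ?_ hhalf hv
      intro v hv
      obtain ⟨j, hj, rfl⟩ := (pow_eq_pow_iff_exists_turn hn).mp hv
      have hin : ⟪halfTurn n * w, turn n ^ j * w⟫ = ‖w‖ ^ 2 * (cos (π / n) -
          2 * sin (j * (π / n)) * (sin (j * (π / n)) * cos (π / n) -
            cos (j * (π / n)) * sin (π / n))) := by
        have e : turn n ^ j * w * conj (halfTurn n * w) =
            (‖w‖ ^ 2 : ℝ) * (turn n ^ j * conj (halfTurn n)) := by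
          rw [map_mul]
          push_cast
          rw [← Complex.mul_conj']
          ring
        rw [Complex.inner, e, Complex.re_ofReal_mul, re_turn_pow_mul, Complex.conj_re,
          Complex.conj_im, halfTurn_re, halfTurn_im]
        ring
      have hnonneg : 0 ≤ 2 * sin (j * (π / n)) * (sin (j * (π / n)) * cos (π / n) -
            cos (j * (π / n)) * sin (π / n)) := by
        rcases Nat.eq_zero_or_pos j with rfl | hj0
        · simp
        · have h2 := abs_cos_mul_sin_le hn hj0 hj
          have h3 : cos (j * (π / n)) * sin (π / n) ≤ |cos (j * (π / n))| * sin (π / n) := by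
            gcongr
            exact le_abs_self _
          exact mul_nonneg (mul_nonneg zero_le_two (sin_natCast_mul_angle_nonneg hn hj.le))
            (by linarith)
      rw [Set.mem_ofPred_eq, real_inner_smul_left, hin, inv_mul_le_iff₀ hr, ← mul_assoc, ← sq]
      gcongr
      linarith
  have h2 : area (polarBody K) ≤ n * ((‖w‖⁻¹) ^ 2 * (sin (π / n) / cos (π / n))) := by
    refine area_le_of_inner_le hn (turn_mul_mem_polarBody_iff hn hs) (q := ‖w‖⁻¹ • w) ?_
      (by positivity) fun v hv => ?_
    · rw [norm_smul, norm_inv, norm_norm, inv_mul_cancel₀ hr.ne']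
    · rw [real_inner_smul_left, real_inner_comm]
      exact mul_le_of_le_one_right (by positivity) (hv w hwK)
  calc area K * area (polarBody K) ≤ _ := mul_le_mul h1 h2 ENNReal.toReal_nonneg (by positivity)
    _ = _ := by field_simp

/-- For a planar convex body with `n`-fold rotational symmetry about the origin
(`n ≥ 3`), `|K|·|K*| ≥ n² sin²(π/n)`, with equality iff `K` is a regular `n`-gon
centred at `o`. -/
theorem volume_product_nfold_symmetry (n : ℕ) (hn : 3 ≤ n) (K : Set ℂ)
    (hK : IsConvexBody K) (ho : (0 : ℂ) ∈ interior K)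
    (hsym : HasNFoldSymmetry n K) :
    (n : ℝ) ^ 2 * Real.sin (π / n) ^ 2 ≤ area K * area (polarBody K) ∧
      (area K * area (polarBody K) = (n : ℝ) ^ 2 * Real.sin (π / n) ^ 2 ↔
        ∃ w : ℂ, IsRegularNgon n 0 w K) := by
  have hs : ∀ w, turn n * w ∈ K ↔ w ∈ K := by
    intro w
    conv_lhs => rw [← hsym]
    exact Set.smul_mem_smul_set_iff₀ (turn_ne_zero n) K w
  have hle := le_area_mul_area_polarBody hn hK.1 hK.2.1 ho hs
  refine ⟨hle, exists_isRegularNgon_of_area_mul_eq hn hK.1 hK.2.1 ho hs, ?_⟩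
  rintro ⟨w, hw⟩
  exact (area_mul_area_polarBody_le_of_isRegularNgon hn hs hw).antisymm hle
end

section
/- Let K be a convex body in ℝ² with o in the interior of K, let T be a triangle, and suppose |K|·|K*| ≤ (1+ε)·27/4 for some ε > 0. Then δ_BM(K,T) ≤ 1 + 900ε. -/
open MeasureTheory Pointwise Real
open scoped RealInnerProductSpace

/-- `K` is a (nondegenerate) triangle. -/
def IsTriangle (K : Set ℂ) : Prop :=
  ∃ a b c : ℂ, AffineIndependent ℝ ![a, b, c] ∧ K = convexHull ℝ {a, b, c}

/-- Banach–Mazur distance of two planar convex bodies: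
`inf {λ₂/λ₁ : ∃ invertible affine A and x with λ₁·A(K) ⊆ L ⊆ λ₂·A(K) + x}`. -/
noncomputable def distBM (K L : Set ℂ) : ℝ :=
  sInf {r : ℝ | ∃ (l1 l2 : ℝ) (A : ℂ ≃ᵃ[ℝ] ℂ) (x : ℂ), 0 < l1 ∧ 0 < l2 ∧ r = l2 / l1 ∧
    l1 • (A '' K) ⊆ L ∧ L ⊆ x +ᵥ l2 • (A '' K)}


/-- Twice the signed area of the triangle `a b c`. -/
def crossArea (a b c : ℂ) : ℝ :=
  (b.re - a.re) * (c.im - a.im) - (b.im - a.im) * (c.re - a.re)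

/-- The open triangle with positively oriented vertices `a b c` (empty for other orientations). -/
def openTriangle (a b c : ℂ) : Set ℂ :=
  {z | 0 < crossArea a b z ∧ 0 < crossArea b c z ∧ 0 < crossArea c a z}

/-- The real-linear endomorphism of `ℂ` sending `1` to `p` and `I` to `q`. -/
noncomputable def columnMap (p q : ℂ) : ℂ →ₗ[ℝ] ℂ where
  toFun z := ⟨z.re * p.re + z.im * q.re, z.re * p.im + z.im * q.im⟩
  map_add' z w := by apply Complex.ext <;> simp <;> ring
  map_smul' r z := by apply Complex.ext <;> simp <;> ring

@[simp] lemma columnMap_re (p q z : ℂ) : (columnMap p q z).re = z.re * p.re + z.im * q.re := rfl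

@[simp] lemma columnMap_im (p q z : ℂ) : (columnMap p q z).im = z.re * p.im + z.im * q.im := rfl

lemma det_columnMap (p q : ℂ) :
    LinearMap.det (columnMap p q) = p.re * q.im - p.im * q.re := by
  rw [← LinearMap.det_toMatrix Complex.basisOneI, Matrix.det_fin_two]
  simp [LinearMap.toMatrix_apply]
  ring

lemma crossArea_columnMap (p q x y z c : ℂ) :
    crossArea (c + columnMap p q x) (c + columnMap p q y) (c + columnMap p q z) =
      (p.re * q.im - p.im * q.re) * crossArea x y z := by
  simp [crossArea]
  ring

lemma volume_standard_triangle :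
    volume {z : ℂ | 0 < z.re ∧ 0 < z.im ∧ z.re + z.im < 1} = ENNReal.ofReal (1 / 2) := by
  have h1 : {z : ℂ | 0 < z.re ∧ 0 < z.im ∧ z.re + z.im < 1} =
      Complex.measurableEquivRealProd ⁻¹'
        (regionBetween (fun _ => 0) (fun x => 1 - x) (Set.Ioo 0 1)) := by
    ext z
    simp only [regionBetween, Set.mem_ofPred_eq, Set.mem_preimage, Set.mem_Ioo,
      Complex.measurableEquivRealProd_apply]
    constructor
    · rintro ⟨h1, h2, h3⟩
      exact ⟨⟨h1, by linarith⟩, h2, by linarith⟩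
    · rintro ⟨⟨h1, _⟩, h2, h3⟩
      exact ⟨h1, h2, by linarith⟩
  have hm : MeasurableSet (regionBetween (fun _ : ℝ => (0 : ℝ)) (fun x => 1 - x) (Set.Ioo 0 1)) :=
    measurableSet_regionBetween (by fun_prop) (by fun_prop) measurableSet_Ioo
  rw [h1, Complex.volume_preserving_equiv_real_prod.measure_preimage hm.nullMeasurableSet]
  have hv := volume_regionBetween_eq_integral (μ := volume) (f := fun _ : ℝ => (0 : ℝ))
    (g := fun x => 1 - x) (s := Set.Ioo 0 1)
    ((continuous_const.integrableOn_Icc).mono_set Set.Ioo_subset_Icc_self)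
    (((by fun_prop : Continuous fun x : ℝ => 1 - x).integrableOn_Icc).mono_set
      Set.Ioo_subset_Icc_self) measurableSet_Ioo (fun x hx => by linarith [hx.2])
  have hi : ∫ y in Set.Ioo (0 : ℝ) 1, ((fun x : ℝ => 1 - x) - fun _ : ℝ => (0 : ℝ)) y = 1 / 2 := by
    rw [← integral_Ioc_eq_integral_Ioo, ← intervalIntegral.integral_of_le zero_le_one]
    simp only [Pi.sub_apply, sub_zero]
    rw [intervalIntegral.integral_sub (by simp) (by simp)]
    norm_num
  rw [hi] at hv
  exact hv

lemma isOpen_openTriangle (a b c : ℂ) : IsOpen (openTriangle a b c) := by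
  have h (p q : ℂ) : IsOpen {z : ℂ | 0 < crossArea p q z} :=
    isOpen_lt continuous_const (by unfold crossArea; fun_prop)
  exact (h a b).inter ((h b c).inter (h c a))

lemma le_volume_openTriangle (a b c : ℂ) :
    ENNReal.ofReal (crossArea a b c / 2) ≤ volume (openTriangle a b c) := by
  rcases le_or_gt (crossArea a b c) 0 with h | h
  · rw [ENNReal.ofReal_of_nonpos (by linarith)]
    exact zero_le
  have hd : (b - a).re * (c - a).im - (b - a).im * (c - a).re = crossArea a b c := by
    simp [crossArea]
  have hsub : (fun z => a + z) '' (columnMap (b - a) (c - a) ''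
      {z : ℂ | 0 < z.re ∧ 0 < z.im ∧ z.re + z.im < 1}) ⊆ openTriangle a b c := by
    rintro _ ⟨_, ⟨z, ⟨h1, h2, h3⟩, rfl⟩, rfl⟩
    refine ⟨?_, ?_, ?_⟩
    · have : crossArea a b (a + columnMap (b - a) (c - a) z) = z.im * crossArea a b c := by
        simp [crossArea]; ring
      rw [this]; positivity
    · have : crossArea b c (a + columnMap (b - a) (c - a) z) =
          (1 - z.re - z.im) * crossArea a b c := by
        simp [crossArea]; ring
      rw [this]; exact mul_pos (by linarith) h
    · have : crossArea c a (a + columnMap (b - a) (c - a) z) = z.re * crossArea a b c := by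
        simp [crossArea]; ring
      rw [this]; positivity
  refine le_trans (le_of_eq ?_) (measure_mono hsub)
  rw [Set.image_add_left, measure_preimage_add, Measure.addHaar_image_linearMap, det_columnMap,
    volume_standard_triangle, hd, abs_of_pos h, ← ENNReal.ofReal_mul h.le]
  congr 1
  ring

lemma openTriangle_subset {C : Set ℂ} (hC : Convex ℝ C) {a b c : ℂ} (ha : a ∈ C) (hb : b ∈ C)
    (hc : c ∈ C) : openTriangle a b c ⊆ C := by
  rintro z ⟨h1, h2, h3⟩
  have hs : crossArea b c z + crossArea c a z + crossArea a b z = crossArea a b c := by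
    simp [crossArea]; ring
  have hp : 0 < crossArea a b c := by linarith
  have := hC.sum_mem (t := Finset.univ)
    (w := ![crossArea b c z / crossArea a b c, crossArea c a z / crossArea a b c,
      crossArea a b z / crossArea a b c]) (z := ![a, b, c])
    (by intro i _; fin_cases i <;> simp <;> positivity)
    (by simp [Fin.sum_univ_three]; field_simp; linarith)
    (by intro i _; fin_cases i <;> simpa)
  convert this
  simp only [Fin.sum_univ_three]
  simp only [Matrix.cons_val]
  apply Complex.ext <;> simp <;> field_simp <;> simp only [crossArea] <;> ring

/-- Pairwise disjoint open triangles with vertices in a convex set bound its area from below. -/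
lemma sum_crossArea_le_area {C : Set ℂ} (hC : Convex ℝ C) (hfin : volume C ≠ ⊤) {n : ℕ}
    (a b c : Fin n → ℂ) (ha : ∀ i, a i ∈ C) (hb : ∀ i, b i ∈ C) (hc : ∀ i, c i ∈ C)
    (hd : ∀ i j, i < j → Disjoint (openTriangle (a i) (b i) (c i))
      (openTriangle (a j) (b j) (c j))) :
    ∑ i, crossArea (a i) (b i) (c i) / 2 ≤ area C := by
  have hpw : Pairwise (Function.onFun Disjoint fun i => openTriangle (a i) (b i) (c i)) := by
    intro i j hij
    rcases lt_or_gt_of_ne hij with h | h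
    · exact hd i j h
    · exact (hd j i h).symm
  have h1 : ∑ i, volume (openTriangle (a i) (b i) (c i)) ≤ volume C := by
    rw [← tsum_fintype (L := .unconditional _), ← 
      measure_iUnion hpw fun i => (isOpen_openTriangle _ _ _).measurableSet]
    exact measure_mono (Set.iUnion_subset fun i => openTriangle_subset hC (ha i) (hb i) (hc i))
  have h2 : ENNReal.ofReal (∑ i, crossArea (a i) (b i) (c i) / 2) ≤ volume C := by
    refine le_trans ?_ h1
    refine le_trans ?_ (Finset.sum_le_sum fun i _ => le_volume_openTriangle (a i) (b i) (c i))
    induction (Finset.univ : Finset (Fin n)) using Finset.induction_on with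
    | empty => simp
    | insert i s hi ih =>
      rw [Finset.sum_insert hi, Finset.sum_insert hi]
      exact ENNReal.ofReal_add_le.trans (by gcongr)
  exact (ENNReal.ofReal_le_iff_le_toReal hfin).1 h2

/-- Area of the convex hull of the triangle `0, 1, I` with one cap vertex over each side, and one
further point `z` beyond the side `1, x` of the first cap. -/
lemma capped_triangle_le_area {S : Set ℂ} (hS : Convex ℝ S) (hfin : volume S ≠ ⊤)
    (h0 : 0 ∈ S) (h1 : 1 ∈ S) (hI : Complex.I ∈ S) (hre : ∀ y ∈ S, y.re ≤ 1)
    (him : ∀ y ∈ S, y.im ≤ 1) (hsum : ∀ y ∈ S, 0 ≤ y.re + y.im)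
    {x x₂ x₃ z : ℂ} (hx : x ∈ S) (hx₂ : x₂ ∈ S) (hx₃ : x₃ ∈ S) (hz : z ∈ S)
    (hη : 1 ≤ x.re + x.im) :
    (1 + (x.re + x.im - 1) + -x₂.re + -x₃.im + (x.im * (z.re - 1) + z.im * (1 - x.re))) / 2 ≤
      area S := by
  have key := sum_crossArea_le_area hS hfin (n := 5)
    ![0, 1, Complex.I, 0, 1] ![1, x, x₂, x₃, z] ![Complex.I, Complex.I, 0, 1, x]
    (by intro i; fin_cases i <;> simpa) (by intro i; fin_cases i <;> simpa)
    (by intro i; fin_cases i <;> simpa) ?_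
  · refine le_trans (le_of_eq ?_) key
    simp [Fin.sum_univ_five, crossArea]
    ring
  have t₁ : ∀ y ∈ openTriangle 0 1 Complex.I, 0 < y.re ∧ 0 < y.im ∧ y.re + y.im < 1 := by
    rintro y ⟨h, h', h''⟩
    simp [crossArea] at h h' h''
    exact ⟨h'', h, by linarith⟩
  have t₂ : ∀ y ∈ openTriangle 1 x Complex.I,
      y ∈ S ∧ 1 < y.re + y.im ∧ x.im * (y.re - 1) + y.im * (1 - x.re) < 0 := by
    intro y hy
    refine ⟨openTriangle_subset hS h1 hx hI hy, ?_⟩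
    obtain ⟨h, h', h''⟩ := hy
    simp [crossArea] at h h' h''
    exact ⟨by linarith, by linarith⟩
  have t₃ : ∀ y ∈ openTriangle Complex.I x₂ 0, y ∈ S ∧ y.re < 0 := by
    intro y hy
    refine ⟨openTriangle_subset hS hI hx₂ h0 hy, ?_⟩
    obtain ⟨h, h', h''⟩ := hy
    simp [crossArea] at h h' h''
    linarith
  have t₄ : ∀ y ∈ openTriangle 0 x₃ 1, y ∈ S ∧ y.im < 0 := by
    intro y hy
    refine ⟨openTriangle_subset hS h0 hx₃ h1 hy, ?_⟩
    obtain ⟨h, h', h''⟩ := hy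
    simp [crossArea] at h h' h''
    linarith
  have t₅ : ∀ y ∈ openTriangle 1 z x,
      y ∈ S ∧ 1 < y.re + y.im ∧ 0 < x.im * (y.re - 1) + y.im * (1 - x.re) := by
    intro y hy
    have hyS := openTriangle_subset hS h1 hz hx hy
    obtain ⟨h, h', h''⟩ := hy
    simp [crossArea] at h h' h''
    have hf : 0 < x.im * (y.re - 1) + y.im * (1 - x.re) := by linarith
    refine ⟨hyS, ?_, hf⟩
    by_contra! hc
    have := hre y hyS
    have := hre x hx
    nlinarith [mul_nonneg (sub_nonneg.2 (hre y hyS)) (sub_nonneg.2 hη),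
      mul_nonneg (sub_nonneg.2 (hre x hx)) (sub_nonneg.2 hc)]
  intro i j hij
  rw [Set.disjoint_left]
  intro y hi hj
  fin_cases i <;> fin_cases j <;> simp at hij hi hj
  · have := t₁ y hi; have := t₂ y hj; linarith
  · have := t₁ y hi; have := t₃ y hj; linarith
  · have := t₁ y hi; have := t₄ y hj; linarith
  · have := t₁ y hi; have := t₅ y hj; linarith
  · have := t₂ y hi; have := t₃ y hj; linarith [him y this.1]
  · have := t₂ y hi; have := t₄ y hj; linarith [hre y this.1]
  · have := t₂ y hi; have := t₅ y hj; linarith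
  · have := t₃ y hi; have := t₄ y hj; linarith [hsum y this.1]
  · have := t₃ y hi; have := t₅ y hj; linarith [him y this.1]
  · have := t₄ y hi; have := t₅ y hj; linarith [hre y this.1]

/-- Area of a heptagon around the origin: six vertices on the rays spanned by
`±1`, `±I`, `±(1 + I)`, and one vertex `m` between the rays of `1` and `1 + I`. -/
lemma heptagon_le_area {C : Set ℂ} (hC : Convex ℝ C) (hfin : volume C ≠ ⊤)
    {a₁ a₂ a₃ b₁ b₂ b₃ : ℝ} {m : ℂ} (ha₁ : 0 < a₁) (ha₂ : 0 < a₂) (ha₃ : 0 < a₃)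
    (hb₁ : 0 < b₁) (hb₂ : 0 < b₂) (hb₃ : 0 < b₃) (hm₀ : 0 ≤ m.im) (hm₁ : m.im ≤ m.re)
    (h0 : 0 ∈ C) (hA₁ : (⟨-a₁, -a₁⟩ : ℂ) ∈ C) (hA₂ : (⟨a₂, 0⟩ : ℂ) ∈ C)
    (hA₃ : (⟨0, a₃⟩ : ℂ) ∈ C) (hB₁ : (⟨b₁, b₁⟩ : ℂ) ∈ C) (hB₂ : (⟨-b₂, 0⟩ : ℂ) ∈ C)
    (hB₃ : (⟨0, -b₃⟩ : ℂ) ∈ C) (hm : m ∈ C) :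
    (a₁ * b₂ + a₁ * b₃ + a₂ * b₃ + a₃ * b₁ + a₃ * b₂ + (a₂ * m.im + b₁ * (m.re - m.im))) / 2 ≤
      area C := by
  have key := sum_crossArea_le_area hC hfin (n := 7) (fun _ => 0)
    ![⟨-a₁, -a₁⟩, ⟨0, -b₃⟩, ⟨a₂, 0⟩, m, ⟨b₁, b₁⟩, ⟨0, a₃⟩, ⟨-b₂, 0⟩]
    ![⟨0, -b₃⟩, ⟨a₂, 0⟩, m, ⟨b₁, b₁⟩, ⟨0, a₃⟩, ⟨-b₂, 0⟩, ⟨-a₁, -a₁⟩]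
    (fun _ => h0) (by intro i; fin_cases i <;> simpa) (by intro i; fin_cases i <;> simpa) ?_
  · refine le_trans (le_of_eq ?_) key
    simp [Fin.sum_univ_seven, crossArea]
    ring
  have sector {p q y : ℂ} (hy : y ∈ openTriangle 0 p q) :
      0 < p.re * y.im - p.im * y.re ∧ 0 < y.re * q.im - y.im * q.re := by
    obtain ⟨h, -, h'⟩ := hy
    simp [crossArea] at h h'
    exact ⟨by linarith, by linarith⟩
  have t₁ : ∀ y ∈ openTriangle 0 ⟨-a₁, -a₁⟩ ⟨0, -b₃⟩, y.im < y.re ∧ y.re < 0 := by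
    intro y hy
    obtain ⟨h, h'⟩ := sector hy
    simp at h h'
    exact ⟨by nlinarith, by nlinarith⟩
  have t₂ : ∀ y ∈ openTriangle 0 ⟨0, -b₃⟩ ⟨a₂, 0⟩, 0 < y.re ∧ y.im < 0 := by
    intro y hy
    obtain ⟨h, h'⟩ := sector hy
    simp at h h'
    exact ⟨by nlinarith, by nlinarith⟩
  have t₃ : ∀ y ∈ openTriangle 0 ⟨a₂, 0⟩ m,
      0 < y.im ∧ 0 < y.re * m.im - y.im * m.re := by
    intro y hy
    obtain ⟨h, h'⟩ := sector hy
    simp at h h'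
    exact ⟨by nlinarith, by nlinarith⟩
  have t₄ : ∀ y ∈ openTriangle 0 m ⟨b₁, b₁⟩,
      y.im < y.re ∧ y.re * m.im - y.im * m.re < 0 := by
    intro y hy
    obtain ⟨h, h'⟩ := sector hy
    simp at h h'
    exact ⟨by nlinarith, by nlinarith⟩
  have t₅ : ∀ y ∈ openTriangle 0 ⟨b₁, b₁⟩ ⟨0, a₃⟩, y.re < y.im ∧ 0 < y.re := by
    intro y hy
    obtain ⟨h, h'⟩ := sector hy
    simp at h h'
    exact ⟨by nlinarith, by nlinarith⟩
  have t₆ : ∀ y ∈ openTriangle 0 ⟨0, a₃⟩ ⟨-b₂, 0⟩, y.re < 0 ∧ 0 < y.im := by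
    intro y hy
    obtain ⟨h, h'⟩ := sector hy
    simp at h h'
    exact ⟨by nlinarith, by nlinarith⟩
  have t₇ : ∀ y ∈ openTriangle 0 ⟨-b₂, 0⟩ ⟨-a₁, -a₁⟩, y.im < 0 ∧ y.re < y.im := by
    intro y hy
    obtain ⟨h, h'⟩ := sector hy
    simp at h h'
    exact ⟨by nlinarith, by nlinarith⟩
  have t₃' : ∀ y ∈ openTriangle 0 ⟨a₂, 0⟩ m, 0 < y.im ∧ y.im < y.re := by
    intro y hy
    obtain ⟨h, h'⟩ := t₃ y hy
    refine ⟨h, ?_⟩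
    by_contra! hc
    nlinarith [mul_nonneg hm₀ (sub_nonneg.2 hc), mul_nonneg h.le (sub_nonneg.2 hm₁)]
  have t₄' : ∀ y ∈ openTriangle 0 m ⟨b₁, b₁⟩, 0 < y.im ∧ y.im < y.re := by
    intro y hy
    obtain ⟨h, h'⟩ := t₄ y hy
    refine ⟨?_, h⟩
    by_contra! hc
    nlinarith [mul_nonneg hm₀ (sub_nonneg.2 h.le), mul_nonneg (neg_nonneg.2 hc) (sub_nonneg.2 hm₁)]
  intro i j hij
  rw [Set.disjoint_left]
  intro y hi hj
  fin_cases i <;> fin_cases j <;> simp at hij hi hj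
  · have := t₁ y hi; have := t₂ y hj; linarith
  · have := t₁ y hi; have := t₃' y hj; linarith
  · have := t₁ y hi; have := t₄' y hj; linarith
  · have := t₁ y hi; have := t₅ y hj; linarith
  · have := t₁ y hi; have := t₆ y hj; linarith
  · have := t₁ y hi; have := t₇ y hj; linarith
  · have := t₂ y hi; have := t₃' y hj; linarith
  · have := t₂ y hi; have := t₄' y hj; linarith
  · have := t₂ y hi; have := t₅ y hj; linarith
  · have := t₂ y hi; have := t₆ y hj; linarith
  · have := t₂ y hi; have := t₇ y hj; linarith
  · have := t₃ y hi; have := t₄ y hj; linarith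
  · have := t₃' y hi; have := t₅ y hj; linarith
  · have := t₃' y hi; have := t₆ y hj; linarith
  · have := t₃' y hi; have := t₇ y hj; linarith
  · have := t₄' y hi; have := t₅ y hj; linarith
  · have := t₄' y hi; have := t₆ y hj; linarith
  · have := t₄' y hi; have := t₇ y hj; linarith
  · have := t₅ y hi; have := t₆ y hj; linarith
  · have := t₅ y hi; have := t₇ y hj; linarith
  · have := t₆ y hi; have := t₇ y hj; linarith

lemma mul_three_le_cube {a b c : ℝ} (ha : 0 < a) (hb : 0 < b) (hc : 0 < c) :
    27 * (a * b * c) ≤ (a + b + c) ^ 3 := by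
  nlinarith [mul_nonneg ha.le (sq_nonneg (b - c)), mul_nonneg hb.le (sq_nonneg (a - c)),
    mul_nonneg hc.le (sq_nonneg (a - b)), mul_nonneg ha.le (sq_nonneg (a - c)),
    mul_nonneg ha.le (sq_nonneg (a - b)), mul_nonneg hb.le (sq_nonneg (b - c)),
    mul_nonneg hb.le (sq_nonneg (a - b)), mul_nonneg hc.le (sq_nonneg (b - c)),
    mul_nonneg hc.le (sq_nonneg (a - c))]

lemma mul_sum_inv_ge {y₁ y₂ y₃ b₁ b₂ b₃ : ℝ} (hy₁ : 0 < y₁) (hy₂ : 0 < y₂) (hy₃ : 0 < y₃)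
    (hb₁ : 0 < b₁) (hb₂ : 0 < b₂) (hb₃ : 0 < b₃) :
    27 ≤ (1 / (y₁ * b₁) + 1 / (y₂ * b₂) + 1 / (y₃ * b₃)) ^ 3 *
      ((y₁ * y₂ * y₃) * (b₁ * b₂ * b₃)) := by
  have h := mul_three_le_cube (a := 1 / (y₁ * b₁)) (b := 1 / (y₂ * b₂)) (c := 1 / (y₃ * b₃))
    (by positivity) (by positivity) (by positivity)
  calc (27 : ℝ) = 27 * (1 / (y₁ * b₁) * (1 / (y₂ * b₂)) * (1 / (y₃ * b₃))) *
        ((y₁ * y₂ * y₃) * (b₁ * b₂ * b₃)) := by field_simp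
    _ ≤ _ := by gcongr

lemma four_mul_mul_le {y₁ y₂ y₃ : ℝ} (hy₁ : 0 < y₁) :
    4 * (y₁ * y₂ * y₃) ≤ y₁ * (y₂ + y₃) ^ 2 := by
  nlinarith [mul_nonneg hy₁.le (sq_nonneg (y₂ - y₃))]

lemma four_div_le_inv_add_inv {a b : ℝ} (ha : 0 < a) (hb : 0 < b) :
    4 / (a + b) ≤ 1 / a + 1 / b := by
  rw [div_add_div _ _ ha.ne' hb.ne', div_le_div_iff₀ (by positivity) (by positivity)]
  nlinarith [sq_nonneg (a - b)]

lemma bounds_of_cubic_ge {t : ℝ} (h₂ : t < 1)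
    (h : 9.384 ≤ (1 + t) * (3 - t) ^ 2) : 3 / 20 ≤ t ∧ t ≤ 1 / 2 := by
  norm_num at h
  constructor
  · by_contra! hc
    have h3 : 0 < t ^ 2 - 4.85 * t + 2.2725 := by norm_num; linarith [sq_nonneg t]
    have h4 := mul_pos (sub_pos.2 hc) h3
    norm_num at h4
    linarith
  · by_contra! hc
    have h3 : 0 < 4.5 * t - t ^ 2 - 0.75 := by
      norm_num
      linarith [mul_pos (sub_pos.2 hc) (sub_pos.2 h₂)]
    have h4 := mul_pos (sub_pos.2 hc) h3
    norm_num at h4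
    linarith

/-- The hexagon part of the area product is at least `27`, and the extremal configuration is
stable: near-equality confines the barycentric coordinates `tᵢ` and the widths `yᵢ`. -/
lemma hexagon_product_stability {t₁ t₂ t₃ y₁ y₂ y₃ s : ℝ} (ht : t₁ + t₂ + t₃ = 1)
    (ht₁ : t₁ < 1) (ht₂ : t₂ < 1) (ht₃ : t₃ < 1) (hy₁ : 0 < y₁) (hy₂ : 0 < y₂) (hy₃ : 0 < y₃)
    (hs : y₁ + y₂ + y₃ = s) {H : ℝ}
    (hH : H = 1 / (1 - t₁) * (1 / y₂) + 1 / (1 - t₁) * (1 / y₃) + 1 / (1 - t₂) * (1 / y₃) +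
      1 / (1 - t₃) * (1 / y₁) + 1 / (1 - t₃) * (1 / y₂) + 1 / (1 - t₂) * (1 / y₁)) :
    27 ≤ s * H ∧ (s * H ≤ 27 * (1 + 1 / 300) →
      y₁ ≤ 2 / 5 * s ∧ 3 / 20 ≤ t₁ ∧ t₁ ≤ 1 / 2 ∧ 3 / 20 ≤ t₂ ∧ t₃ ≤ 1 / 2) := by
  set W := 1 / (y₁ * (1 + t₁)) + 1 / (y₂ * (1 + t₂)) + 1 / (y₃ * (1 + t₃)) with hW
  have hb₁ : 0 < 1 + t₁ := by linarith
  have hb₂ : 0 < 1 + t₂ := by linarith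
  have hb₃ : 0 < 1 + t₃ := by linarith
  have hs0 : 0 < s := by linarith
  have hW0 : 0 < W := by positivity
  have hWH : 4 * W ≤ H := by
    have e₁ := mul_le_mul_of_nonneg_left
      (four_div_le_inv_add_inv (sub_pos.2 ht₂) (sub_pos.2 ht₃)) (one_div_pos.2 hy₁).le
    have e₂ := mul_le_mul_of_nonneg_left
      (four_div_le_inv_add_inv (sub_pos.2 ht₁) (sub_pos.2 ht₃)) (one_div_pos.2 hy₂).le
    have e₃ := mul_le_mul_of_nonneg_left
      (four_div_le_inv_add_inv (sub_pos.2 ht₁) (sub_pos.2 ht₂)) (one_div_pos.2 hy₃).le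
    have f₁ : 1 / y₁ * (4 / (1 - t₂ + (1 - t₃))) = 4 * (1 / (y₁ * (1 + t₁))) := by
      rw [show 1 - t₂ + (1 - t₃) = 1 + t₁ by linarith]; field_simp
    have f₂ : 1 / y₂ * (4 / (1 - t₁ + (1 - t₃))) = 4 * (1 / (y₂ * (1 + t₂))) := by
      rw [show 1 - t₁ + (1 - t₃) = 1 + t₂ by linarith]; field_simp
    have f₃ : 1 / y₃ * (4 / (1 - t₁ + (1 - t₂))) = 4 * (1 / (y₃ * (1 + t₃))) := by
      rw [show 1 - t₁ + (1 - t₂) = 1 + t₃ by linarith]; field_simp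
    rw [f₁] at e₁
    rw [f₂] at e₂
    rw [f₃] at e₃
    rw [hH, hW]
    linarith
  have hamgm := mul_sum_inv_ge hy₁ hy₂ hy₃ hb₁ hb₂ hb₃
  rw [← hW] at hamgm
  have hP := mul_three_le_cube hy₁ hy₂ hy₃
  have hQ := mul_three_le_cube hb₁ hb₂ hb₃
  have hQ0 : 0 < (1 + t₁) * (1 + t₂) * (1 + t₃) := by positivity
  have hP0 : 0 < y₁ * y₂ * y₃ := by positivity
  rw [hs] at hP
  rw [show 1 + t₁ + (1 + t₂) + (1 + t₃) = 4 by linarith] at hQ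
  have hy := four_mul_mul_le (y₂ := y₂) (y₃ := y₃) hy₁
  have hb₁' := four_mul_mul_le (y₂ := 1 + t₂) (y₃ := 1 + t₃) hb₁
  have hb₂' := four_mul_mul_le (y₂ := 1 + t₁) (y₃ := 1 + t₃) hb₂
  have hb₃' := four_mul_mul_le (y₂ := 1 + t₁) (y₃ := 1 + t₂) hb₃
  rw [show y₂ + y₃ = s - y₁ by linarith] at hy
  rw [show 1 + t₂ + (1 + t₃) = 3 - t₁ by linarith] at hb₁'
  rw [show 1 + t₁ + (1 + t₃) = 3 - t₂ by linarith] at hb₂'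
  rw [show 1 + t₁ + (1 + t₂) = 3 - t₃ by linarith] at hb₃'
  set P := y₁ * y₂ * y₃
  set Q := (1 + t₁) * (1 + t₂) * (1 + t₃) with hQdef
  have hPQ : P * Q ≤ s ^ 3 / 27 * Q := by gcongr; linarith
  have hQP : P * Q ≤ P * (64 / 27) := by gcongr; linarith
  have hs3 : 0 < s ^ 3 := by positivity
  have hlow : 27 / 4 ≤ s * W := by
    have h1 : W ^ 3 * (P * Q) ≤ W ^ 3 * (s ^ 3 / 27 * (64 / 27)) := by
      gcongr
      · linarith
      · linarith
    refine le_of_pow_le_pow_left₀ (n := 3) (by norm_num) (by positivity) ?_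
    rw [mul_pow]
    linarith
  have hsWH := mul_le_mul_of_nonneg_left hWH hs0.le
  refine ⟨by linarith, fun hup => ?_⟩
  have hsW : s * W ≤ 6.7725 := by norm_num at hup ⊢; linarith
  have hsW3 : (s * W) ^ 3 ≤ 6.7725 ^ 3 := by gcongr
  rw [mul_pow] at hsW3
  have hPlow : 0.0366 * s ^ 3 ≤ P := by
    have h1 : W ^ 3 * (P * Q) ≤ W ^ 3 * (P * (64 / 27)) := by gcongr
    have h2 : 27 * s ^ 3 ≤ s ^ 3 * W ^ 3 * (P * (64 / 27)) := by
      rw [mul_comm 27, mul_assoc]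
      gcongr
      linarith
    have h3 : s ^ 3 * W ^ 3 * (P * (64 / 27)) ≤ 6.7725 ^ 3 * (P * (64 / 27)) := by gcongr
    norm_num at h3 ⊢
    linarith
  have hQlow : 2.346 ≤ Q := by
    have h1 : W ^ 3 * (P * Q) ≤ W ^ 3 * (s ^ 3 / 27 * Q) := by gcongr
    have h2 : s ^ 3 * W ^ 3 * Q ≤ 6.7725 ^ 3 * Q := by gcongr
    norm_num at h2 ⊢
    linarith
  have tbounds {t : ℝ} (h2 : t < 1) (h3 : 4 * Q ≤ (1 + t) * (3 - t) ^ 2) :=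
    bounds_of_cubic_ge h2 (le_trans (by linarith) h3)
  have q1 : 4 * Q ≤ (1 + t₁) * (3 - t₁) ^ 2 := hb₁'
  have q2 : 4 * Q ≤ (1 + t₂) * (3 - t₂) ^ 2 := by
    refine le_trans (le_of_eq ?_) hb₂'
    rw [hQdef]; ring
  have q3 : 4 * Q ≤ (1 + t₃) * (3 - t₃) ^ 2 := by
    refine le_trans (le_of_eq ?_) hb₃'
    rw [hQdef]; ring
  refine ⟨?_, (tbounds ht₁ q1).1, (tbounds ht₁ q1).2,
    (tbounds ht₂ q2).1, (tbounds ht₃ q3).2⟩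
  by_contra! hc
  have hys : 0 < s - y₁ := by linarith
  have h5 : 0 < 8 / 5 * (s * y₁) - y₁ ^ 2 - 9 / 25 * s ^ 2 := by
    linarith [mul_pos (sub_pos.2 hc) hys, mul_pos hs0 hy₁, mul_pos hs0 hs0]
  have h6 := mul_pos (sub_pos.2 hc) h5
  norm_num at hPlow
  linarith

/-- If the area bounds for a body with cap heights `η₁, η₂, η₃` are nearly extremal, then the
first cap is low. -/
lemma cap_height_le {t₁ t₂ t₃ η₁ η₂ η₃ ρ σ E Y ε H : ℝ} (ht : t₁ + t₂ + t₃ = 1)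
    (ht₁ : t₁ < 1) (ht₂ : t₂ < 1) (ht₃ : t₃ < 1)
    (hy₁ : 0 < t₁ + η₁) (hy₂ : 0 < t₂ + η₂) (hy₃ : 0 < t₃ + η₃)
    (hη₁ : 0 ≤ η₁) (hη₁' : η₁ ≤ 1) (hη₂' : η₂ ≤ 1) (hη₃' : η₃ ≤ 1)
    (h₁₂ : η₁ * (1 + η₂) ≤ 1) (h₁₃ : η₁ * (1 + η₃) ≤ 1)
    (hρσ : ρ + σ = 1 + η₁) (hle : ρ ≤ σ) (hσ : σ ≤ 1) (hE : 0 ≤ E)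
    (hY : Y = E + σ * t₁ + η₁ * t₃) (hY0 : 0 < Y) (hε : 0 < ε)
    (hH : H = 1 / (1 - t₁) * (1 / (t₂ + η₂)) + 1 / (1 - t₁) * (1 / (t₃ + η₃)) +
      1 / (1 - t₂) * (1 / (t₃ + η₃)) + 1 / (1 - t₃) * (1 / (t₁ + η₁)) +
      1 / (1 - t₃) * (1 / (t₂ + η₂)) + 1 / (1 - t₂) * (1 / (t₁ + η₁)))
    (hhex : (1 + η₁ + η₂ + η₃ + E) * H ≤ 27 * (1 + ε))
    (hhept : (1 + η₁ + η₂ + η₃ + E) * (H - 1 / (1 - t₂) * (1 / (t₁ + η₁)) +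
      (1 / (1 - t₂) * ((σ - η₁) / Y) + 1 / (t₁ + η₁) * (η₁ / Y))) ≤ 27 * (1 + ε)) :
    η₁ ≤ 300 * ε := by
  rcases le_or_gt (1 / 300) ε with hbig | hsmall
  · linarith
  set s := 1 + η₁ + η₂ + η₃ with hs
  obtain ⟨hlow, hst⟩ := hexagon_product_stability (s := s) ht ht₁ ht₂ ht₃ hy₁ hy₂ hy₃
    (by rw [hs]; linarith) hH
  have hs0 : 0 < s := by rw [hs]; linarith
  have hs4 : s ≤ 4 := by rw [hs]; linarith
  have hH0 : 0 < H := pos_of_mul_pos_right (by linarith : 0 < s * H) hs0.le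
  have hEH : 0 ≤ E * H := mul_nonneg hE hH0.le
  obtain ⟨hy, t1l, t1u, t2l, t3u⟩ := hst (by linarith)
  have hH4 : 27 / 4 ≤ H := by
    have := mul_le_mul_of_nonneg_right hs4 hH0.le
    linarith
  have hE4 : E ≤ 4 * ε := by
    have := mul_le_mul_of_nonneg_left hH4 hE
    linarith
  have hη : η₁ ≤ 4 / 5 := by
    by_contra! hc
    have : η₁ * (η₂ + η₃) ≤ 2 - 2 * η₁ := by linarith
    have h5 : η₂ + η₃ ≤ 1 / 2 := by
      by_contra! h
      linarith [mul_le_mul hc.le h.le (by norm_num) hη₁]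
    linarith
  set G := (η₁ * (1 - ρ) - E) / (Y * (1 - t₂) * (t₁ + η₁)) with hG
  have h2 : 0 < 1 - t₂ := by linarith
  have hGeq : H - 1 / (1 - t₂) * (1 / (t₁ + η₁)) +
      (1 / (1 - t₂) * ((σ - η₁) / Y) + 1 / (t₁ + η₁) * (η₁ / Y)) = H + G := by
    have : 1 / (1 - t₂) * ((σ - η₁) / Y) + 1 / (t₁ + η₁) * (η₁ / Y) -
        1 / (1 - t₂) * (1 / (t₁ + η₁)) = G := by
      rw [hG]
      field_simp
      rw [hY]
      obtain rfl : ρ = 1 + η₁ - σ := by linarith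
      obtain rfl : t₁ = 1 - t₂ - t₃ := by linarith
      ring
    linarith
  rw [hGeq] at hhept
  have hsG : s * G ≤ 27 * ε := by
    rcases le_or_gt G 0 with hG0 | hG0
    · have := mul_nonneg hs0.le (neg_nonneg.2 hG0)
      linarith
    · have := mul_nonneg hE hG0.le
      linarith
  have hD0 : 0 < Y * (1 - t₂) * (t₁ + η₁) := by positivity
  have hYu : Y ≤ 0.92 := by
    have h5 : σ * t₁ ≤ 1 * (1 / 2) := by gcongr
    have h6 : η₁ * t₃ ≤ η₁ * (1 / 2) := by gcongr
    rw [hY]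
    norm_num
    linarith
  have hD : Y * (1 - t₂) * (t₁ + η₁) ≤ 0.92 * 0.85 * (2 / 5 * s) := by
    gcongr
    linarith
  have hnum : η₁ * (1 - ρ) - E = G * (Y * (1 - t₂) * (t₁ + η₁)) := by
    rw [hG]; field_simp
  have hnum' : η₁ * (1 - ρ) - E ≤ 9 * ε := by
    rcases le_or_gt G 0 with hG0 | hG0
    · have := mul_nonneg hD0.le (neg_nonneg.2 hG0)
      linarith
    · have : G * (Y * (1 - t₂) * (t₁ + η₁)) ≤ G * (0.92 * 0.85 * (2 / 5 * s)) := by gcongr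
      norm_num at this
      linarith
  have hρ : (1 - η₁) / 2 ≤ 1 - ρ := by linarith
  have h7 : η₁ * (1 / 10) ≤ η₁ * (1 - ρ) := mul_le_mul_of_nonneg_left (by linarith) hη₁
  linarith

lemma lt_of_mem_interior {S : Set ℂ} {t : ℂ} (ht : t ∈ interior S) {α β M : ℝ}
    (h : ∀ y ∈ S, α * y.re + β * y.im ≤ M) (hne : 0 < α ^ 2 + β ^ 2) :
    α * t.re + β * t.im < M := by
  have hc : Filter.Tendsto (fun r : ℝ => t + (r : ℂ) * ⟨α, β⟩) (nhdsWithin 0 (Set.Ioi 0))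
      (nhds t) := by
    have : Continuous fun r : ℝ => t + (r : ℂ) * ⟨α, β⟩ := by fun_prop
    simpa using (this.tendsto 0).mono_left nhdsWithin_le_nhds
  have hev := hc.eventually (mem_interior_iff_mem_nhds.1 ht)
  obtain ⟨r, hr, hr0⟩ := (hev.and self_mem_nhdsWithin).exists
  have := h _ hr
  simp at this
  have hr0' : 0 < r := hr0
  have := mul_pos hr0' hne
  linarith

/-- The polar body of `S` with respect to the point `t`, in coordinates. -/
def polarAt (S : Set ℂ) (t : ℂ) : Set ℂ :=
  {w | ∀ y ∈ S, w.re * (y.re - t.re) + w.im * (y.im - t.im) ≤ 1}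

lemma convex_polarAt (S : Set ℂ) (t : ℂ) : Convex ℝ (polarAt S t) := by
  intro v hv w hw a b ha hb hab y hy
  have h1 := mul_le_mul_of_nonneg_left (hv y hy) ha
  have h2 := mul_le_mul_of_nonneg_left (hw y hy) hb
  simp
  linarith

lemma mem_polarAt {S : Set ℂ} {t w : ℂ} {α β M N : ℝ}
    (h : ∀ y ∈ S, α * y.re + β * y.im ≤ M) (hN : M - (α * t.re + β * t.im) = N) (hpos : 0 < N)
    (hre : w.re = α / N) (him : w.im = β / N) : w ∈ polarAt S t := by
  intro y hy
  rw [hre, him]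
  have : α / N * (y.re - t.re) + β / N * (y.im - t.im) =
      ((α * y.re + β * y.im) - (α * t.re + β * t.im)) / N := by ring
  rw [this, div_le_one hpos]
  linarith [h y hy]

/-- Cap height bound for a body whose maximal inscribed triangle is `0, 1, I`. -/
lemma normalized_cap_height_le {S : Set ℂ} (hS : Convex ℝ S) (hcpt : IsCompact S) (h0 : 0 ∈ S)
    (h1 : 1 ∈ S) (hI : Complex.I ∈ S)
    (hmax : ∀ x ∈ S, ∀ y ∈ S, ∀ z ∈ S, crossArea x y z ≤ 1) {t : ℂ} (ht : t ∈ interior S)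
    (hfin : volume (polarAt S t) ≠ ⊤) {ε : ℝ} (hε : 0 < ε)
    (hvp : area S * area (polarAt S t) ≤ (1 + ε) * (27 / 4)) {x : ℂ} (hx : x ∈ S)
    (hxmax : ∀ y ∈ S, y.re + y.im ≤ x.re + x.im) (hle : x.re ≤ x.im) :
    x.re + x.im - 1 ≤ 300 * ε := by
  have hre : ∀ y ∈ S, y.re ≤ 1 := fun y hy => by
    simpa [crossArea] using hmax 0 h0 y hy _ hI
  have him : ∀ y ∈ S, y.im ≤ 1 := fun y hy => by
    simpa [crossArea] using hmax 0 h0 1 h1 y hy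
  have hsum : ∀ y ∈ S, 0 ≤ y.re + y.im := fun y hy => by
    have := hmax y hy 1 h1 _ hI
    simp [crossArea] at this
    linarith
  have hne : S.Nonempty := ⟨0, h0⟩
  obtain ⟨x₂, hx₂, hx₂min⟩ := hcpt.exists_isMinOn hne Complex.continuous_re.continuousOn
  obtain ⟨x₃, hx₃, hx₃min⟩ := hcpt.exists_isMinOn hne Complex.continuous_im.continuousOn
  obtain ⟨z, hz, hzmax⟩ := hcpt.exists_isMaxOn hne
    (f := fun y : ℂ => x.im * y.re + (1 - x.re) * y.im) (by fun_prop)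
  replace hx₂min : ∀ y ∈ S, x₂.re ≤ y.re := fun y hy => hx₂min hy
  replace hx₃min : ∀ y ∈ S, x₃.im ≤ y.im := fun y hy => hx₃min hy
  replace hzmax : ∀ y ∈ S, x.im * y.re + (1 - x.re) * y.im ≤ x.im * z.re + (1 - x.re) * z.im :=
    fun y hy => hzmax hy
  have hη : 1 ≤ x.re + x.im := by simpa using hxmax 1 h1
  have hη₂ : x₂.re ≤ 0 := by simpa using hx₂min 0 h0
  have hη₃ : x₃.im ≤ 0 := by simpa using hx₃min 0 h0
  have hσ : 0 < x.im := by linarith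
  have ht₁ : 0 < t.re + t.im := by
    have := lt_of_mem_interior (M := 0) (α := -1) (β := -1) ht
      (fun y hy => by linarith [hsum y hy]) (by norm_num)
    linarith
  have ht₂ : t.re < 1 := by
    have := lt_of_mem_interior (M := 1) (α := 1) (β := 0) ht
      (fun y hy => by linarith [hre y hy]) (by norm_num)
    linarith
  have ht₃ : t.im < 1 := by
    have := lt_of_mem_interior (M := 1) (α := 0) (β := 1) ht
      (fun y hy => by linarith [him y hy]) (by norm_num)
    linarith
  have hy₁ : t.re + t.im < x.re + x.im := by
    have := lt_of_mem_interior (M := x.re + x.im) (α := 1) (β := 1) ht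
      (fun y hy => by linarith [hxmax y hy]) (by norm_num)
    linarith
  have hy₂ : x₂.re < t.re := by
    have := lt_of_mem_interior (M := -x₂.re) (α := -1) (β := 0) ht
      (fun y hy => by linarith [hx₂min y hy]) (by norm_num)
    linarith
  have hy₃ : x₃.im < t.im := by
    have := lt_of_mem_interior (M := -x₃.im) (α := 0) (β := -1) ht
      (fun y hy => by linarith [hx₃min y hy]) (by norm_num)
    linarith
  have hYt := lt_of_mem_interior ht hzmax (by positivity)
  set E := x.im * (z.re - 1) + z.im * (1 - x.re) with hE
  have hE0 : 0 ≤ E := by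
    have := hzmax 1 h1
    simp at this
    rw [hE]
    linarith
  have hareaS := capped_triangle_le_area hS hcpt.measure_lt_top.ne h0 h1 hI hre him hsum
    hx hx₂ hx₃ hz hη
  rw [← hE] at hareaS
  set Y := x.im * z.re + (1 - x.re) * z.im - (x.im * t.re + (1 - x.re) * t.im) with hY
  have hY0 : 0 < Y := by rw [hY]; linarith
  set a₁ := 1 / (t.re + t.im) with ha₁
  set a₂ := 1 / (1 - t.re) with ha₂
  set a₃ := 1 / (1 - t.im) with ha₃
  set b₁ := 1 / (x.re + x.im - (t.re + t.im)) with hb₁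
  set b₂ := 1 / (t.re - x₂.re) with hb₂
  set b₃ := 1 / (t.im - x₃.im) with hb₃
  have pos₁ : 0 < a₁ := by positivity
  have pos₂ : 0 < a₂ := one_div_pos.2 (by linarith)
  have pos₃ : 0 < a₃ := one_div_pos.2 (by linarith)
  have qos₁ : 0 < b₁ := one_div_pos.2 (by linarith)
  have qos₂ : 0 < b₂ := one_div_pos.2 (by linarith)
  have qos₃ : 0 < b₃ := one_div_pos.2 (by linarith)
  have hept {m : ℂ} (hm : m ∈ polarAt S t) (hm₀ : 0 ≤ m.im) (hm₁ : m.im ≤ m.re) :=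
    heptagon_le_area (convex_polarAt S t) hfin pos₁ pos₂ pos₃ qos₁ qos₂ qos₃ hm₀ hm₁
      (fun y _ => by simp)
      (mem_polarAt (α := -1) (β := -1) (M := 0) (N := t.re + t.im)
        (fun y hy => by linarith [hsum y hy]) (by ring) ht₁ (by rw [ha₁]; ring) (by rw [ha₁]; ring))
      (mem_polarAt (α := 1) (β := 0) (M := 1) (N := 1 - t.re)
        (fun y hy => by linarith [hre y hy]) (by ring) (by linarith) rfl (by simp))
      (mem_polarAt (α := 0) (β := 1) (M := 1) (N := 1 - t.im)
        (fun y hy => by linarith [him y hy]) (by ring) (by linarith) (by simp) rfl)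
      (mem_polarAt (α := 1) (β := 1) (M := x.re + x.im) (N := x.re + x.im - (t.re + t.im))
        (fun y hy => by linarith [hxmax y hy]) (by ring) (by linarith) rfl rfl)
      (mem_polarAt (α := -1) (β := 0) (M := -x₂.re) (N := t.re - x₂.re)
        (fun y hy => by linarith [hx₂min y hy]) (by ring) (by linarith) (by rw [hb₂]; ring)
        (by simp))
      (mem_polarAt (α := 0) (β := -1) (M := -x₃.im) (N := t.im - x₃.im)
        (fun y hy => by linarith [hx₃min y hy]) (by ring) (by linarith) (by simp)
        (by rw [hb₃]; ring))
      hm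
  have hex := hept (m := ⟨a₂, 0⟩)
    (mem_polarAt (α := 1) (β := 0) (M := 1) (N := 1 - t.re)
      (fun y hy => by linarith [hre y hy]) (by ring) (by linarith) rfl (by simp)) le_rfl pos₂.le
  have hep := hept (m := ⟨x.im / Y, (1 - x.re) / Y⟩)
    (mem_polarAt hzmax hY.symm hY0 rfl rfl)
    (div_nonneg (by linarith [hre x hx]) hY0.le)
    (div_le_div_of_nonneg_right (by linarith) hY0.le)
  have prod {u v : ℝ} (hu : 0 ≤ u) (hu' : u / 2 ≤ area S) (hv' : v / 2 ≤ area (polarAt S t)) :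
      u * v ≤ 27 * (1 + ε) := by
    have hA : 0 ≤ area (polarAt S t) := ENNReal.toReal_nonneg
    have := mul_le_mul_of_nonneg_left hv' (by linarith : 0 ≤ u / 2)
    have := mul_le_mul_of_nonneg_right hu' hA
    linarith
  have hex' := prod (by linarith) hareaS hex
  have hep' := prod (by linarith) hareaS hep
  have m₂ := hmax 1 h1 x hx x₂ hx₂
  have m₃ := hmax _ hI x₃ hx₃ x hx
  simp [crossArea] at m₂ m₃
  have hx_re := hre x hx
  have hx_im := him x hx
  refine cap_height_le (t₁ := 1 - t.re - t.im) (t₂ := t.re) (t₃ := t.im)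
    (η₁ := x.re + x.im - 1) (η₂ := -x₂.re) (η₃ := -x₃.im) (ρ := x.re) (σ := x.im) (E := E) (Y := Y)
    (H := a₁ * b₂ + a₁ * b₃ + a₂ * b₃ + a₃ * b₁ + a₃ * b₂ + a₂ * b₁)
    (by ring) (by linarith) ht₂ ht₃ (by linarith) (by linarith) (by linarith) (by linarith)
    (by linarith) (by linarith [hsum x₂ hx₂, him x₂ hx₂]) (by linarith [hsum x₃ hx₃, hre x₃ hx₃])
    ?_ ?_ (by ring) hle hx_im hE0 ?_ hY0 hε ?_ ?_ ?_
  · linarith [mul_nonneg (sub_nonneg.2 hx_re) (by linarith [him x₂ hx₂] : 0 ≤ 1 - x₂.re - x₂.im)]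
  · linarith [mul_nonneg (sub_nonneg.2 hx_im) (by linarith [hre x₃ hx₃] : 0 ≤ 1 - x₃.im - x₃.re)]
  · rw [hY, hE]; ring
  · rw [show 1 - (1 - t.re - t.im) = t.re + t.im by ring, ← sub_eq_add_neg, ← sub_eq_add_neg,
      show 1 - t.re - t.im + (x.re + x.im - 1) = x.re + x.im - (t.re + t.im) by ring]
  · refine le_trans (le_of_eq ?_) hex'
    ring
  · refine le_trans (le_of_eq ?_) hep'
    rw [show 1 - t.re - t.im + (x.re + x.im - 1) = x.re + x.im - (t.re + t.im) by ring,
      ← ha₂, ← hb₁]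
    ring

lemma volume_polarBody_ne_top {K : Set ℂ} (ho : (0 : ℂ) ∈ interior K) :
    volume (polarBody K) ≠ ⊤ := by
  obtain ⟨r, hr, hball⟩ := Metric.mem_nhds_iff.1 (mem_interior_iff_mem_nhds.1 ho)
  have hsub : polarBody K ⊆ Metric.closedBall 0 (2 / r) := by
    intro x hx
    rw [mem_closedBall_zero_iff]
    rcases eq_or_ne x 0 with rfl | h
    · simp; positivity
    have hn : 0 < ‖x‖ := norm_pos_iff.2 h
    have hmem : (r / 2 / ‖x‖) • x ∈ K := by
      apply hball
      rw [mem_ball_zero_iff, norm_smul, Real.norm_of_nonneg (by positivity)]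
      field_simp
      linarith
    have h1 := hx _ hmem
    rw [real_inner_smul_right, real_inner_self_eq_norm_sq] at h1
    rw [le_div_iff₀ hr]
    have h2 : r / 2 / ‖x‖ * ‖x‖ ^ 2 = r / 2 * ‖x‖ := by field_simp
    linarith
  exact ((measure_mono hsub).trans_lt measure_closedBall_lt_top).ne

/-- `a b c` is a nondegenerate triangle of maximal area inscribed in `K`. -/
structure IsMaxTriangle (K : Set ℂ) (a b c : ℂ) : Prop where
  mem₁ : a ∈ K
  mem₂ : b ∈ K
  mem₃ : c ∈ K
  ne_zero : crossArea a b c ≠ 0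
  abs_le : ∀ x ∈ K, ∀ y ∈ K, ∀ z ∈ K, |crossArea x y z| ≤ |crossArea a b c|

lemma crossArea_swap (a b c : ℂ) : crossArea a c b = -crossArea a b c := by
  simp [crossArea]; ring

lemma crossArea_rotate (a b c : ℂ) : crossArea b c a = crossArea a b c := by
  simp [crossArea]; ring

lemma IsMaxTriangle.swap {K : Set ℂ} {a b c : ℂ} (h : IsMaxTriangle K a b c) :
    IsMaxTriangle K a c b where
  mem₁ := h.mem₁
  mem₂ := h.mem₃
  mem₃ := h.mem₂
  ne_zero := by rw [crossArea_swap]; exact neg_ne_zero.2 h.ne_zero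
  abs_le := by rw [crossArea_swap, abs_neg]; exact h.abs_le

lemma IsMaxTriangle.rotate {K : Set ℂ} {a b c : ℂ} (h : IsMaxTriangle K a b c) :
    IsMaxTriangle K b c a where
  mem₁ := h.mem₂
  mem₂ := h.mem₃
  mem₃ := h.mem₁
  ne_zero := by rw [crossArea_rotate]; exact h.ne_zero
  abs_le := by rw [crossArea_rotate]; exact h.abs_le

lemma exists_isMaxTriangle {K : Set ℂ} (hK : IsConvexBody K) : ∃ a b c, IsMaxTriangle K a b c := by
  obtain ⟨-, hcpt, o, ho⟩ := hK
  have hoK := interior_subset ho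
  obtain ⟨⟨a, b, c⟩, ⟨ha, hb, hc⟩, hmax⟩ :=
    (hcpt.prod (hcpt.prod hcpt)).exists_isMaxOn ⟨(o, o, o), hoK, hoK, hoK⟩
      (f := fun p : ℂ × ℂ × ℂ => |crossArea p.1 p.2.1 p.2.2|) (by unfold crossArea; fun_prop)
  replace hmax : ∀ x ∈ K, ∀ y ∈ K, ∀ z ∈ K, |crossArea x y z| ≤ |crossArea a b c| :=
    fun x hx y hy z hz => hmax (a := (x, y, z)) ⟨hx, hy, hz⟩
  refine ⟨a, b, c, ha, hb, hc, fun h0 => ?_, hmax⟩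
  obtain ⟨r, hr, hball⟩ := Metric.mem_nhds_iff.1 (mem_interior_iff_mem_nhds.1 ho)
  have mem (w : ℂ) (hw : ‖w‖ = 1) : o + (r / 2 : ℝ) * w ∈ K := by
    apply hball
    rw [mem_ball_iff_norm, add_sub_cancel_left, norm_mul, hw, Complex.norm_real,
      Real.norm_of_nonneg (by positivity)]
    linarith
  have := hmax o hoK _ (mem 1 (by simp)) _ (mem Complex.I (by simp))
  rw [h0, abs_zero, abs_nonpos_iff] at this
  simp [crossArea] at this
  exact hr.ne' this

lemma toReal_volume_image_columnMap (p q : ℂ) (s : Set ℂ) :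
    (volume (columnMap p q '' s)).toReal = |p.re * q.im - p.im * q.re| * (volume s).toReal := by
  rw [Measure.addHaar_image_linearMap, det_columnMap, ENNReal.toReal_mul,
    ENNReal.toReal_ofReal (abs_nonneg _)]

lemma cap_bound_of_le {K : Set ℂ} (hconv : Convex ℝ K) (hcpt : IsCompact K)
    (ho : (0 : ℂ) ∈ interior K) {a b c : ℂ} (hT : IsMaxTriangle K a b c) {ε : ℝ} (hε : 0 < ε)
    (hvp : area K * area (polarBody K) ≤ (1 + ε) * (27 / 4)) {x : ℂ} (hx : x ∈ K)
    (hxmin : ∀ y ∈ K, crossArea b c x / crossArea a b c ≤ crossArea b c y / crossArea a b c)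
    (hle : crossArea c a x / crossArea a b c ≤ crossArea a b x / crossArea a b c) :
    -(300 * ε) ≤ crossArea b c x / crossArea a b c := by
  set D := crossArea a b c with hD
  have hD0 : D ≠ 0 := hT.ne_zero
  have hDabs : 0 < |D| := abs_pos.2 hD0
  have hdet : (b - a).re * (c - a).im - (b - a).im * (c - a).re = D := by simp [hD, crossArea]
  set φ : ℂ → ℂ := fun z => a + columnMap (b - a) (c - a) z with hφ
  set ψ : ℂ → ℂ := fun y => ⟨crossArea c a y / D, crossArea a b y / D⟩ with hψ
  have hφψ (y : ℂ) : φ (ψ y) = y := by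
    apply Complex.ext <;> simp [hφ, hψ] <;> field_simp <;> simp [hD, crossArea] <;> ring
  have hψφ (z : ℂ) : ψ (φ z) = z := by
    apply Complex.ext <;> simp [hφ, hψ] <;> field_simp <;> simp [hD, crossArea] <;> ring
  have hφcont : Continuous φ :=
    continuous_const.add (columnMap (b - a) (c - a)).continuous_of_finiteDimensional
  have hψcont : Continuous ψ := by
    have : ψ = fun y => ((crossArea c a y / D : ℝ) : ℂ) + ((crossArea a b y / D : ℝ) : ℂ) *
        Complex.I := by
      funext y
      apply Complex.ext <;> simp [hψ]
    rw [this]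
    unfold crossArea
    fun_prop
  set S := φ ⁻¹' K with hSdef
  have hSψ : S = ψ '' K := by
    ext z
    exact ⟨fun hz => ⟨φ z, hz, hψφ z⟩, by rintro ⟨y, hy, rfl⟩; simpa [hSdef, hφψ] using hy⟩
  have hψS {y : ℂ} (hy : y ∈ K) : ψ y ∈ S := hSψ ▸ Set.mem_image_of_mem ψ hy
  have hSconv : Convex ℝ S := by
    intro v hv w hw α β hα hβ hαβ
    have := hconv hv hw hα hβ hαβ
    obtain rfl : α = 1 - β := by linarith
    have he : φ ((1 - β) • v + β • w) = (1 - β) • φ v + β • φ w := by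
      apply Complex.ext <;> simp [hφ] <;> ring
    rw [hSdef, Set.mem_preimage, he]
    exact this
  have htS : ψ 0 ∈ interior S :=
    interior_maximal (Set.preimage_mono interior_subset) (isOpen_interior.preimage hφcont)
      (by simpa [hφψ] using ho)
  have hareaK : area K = |D| * area S := by
    have : K = (fun z => a + z) '' (columnMap (b - a) (c - a) '' S) := by
      rw [Set.image_image]
      exact (Set.image_preimage_eq K fun y => ⟨ψ y, hφψ y⟩).symm
    unfold area
    conv_lhs => rw [this]
    rw [Set.image_add_left, measure_preimage_add, toReal_volume_image_columnMap, hdet]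
  set p : ℂ := ⟨(b - a).re, (c - a).re⟩
  set q : ℂ := ⟨(b - a).im, (c - a).im⟩
  have hpq : p.re * q.im - p.im * q.re = D := by rw [← hdet]; simp only [p, q]; ring
  have hsub : polarAt S (ψ 0) ⊆ columnMap p q '' polarBody K := by
    intro w hw
    refine ⟨⟨(w.re * (c - a).im - w.im * (b - a).im) / D,
      (w.im * (b - a).re - w.re * (c - a).re) / D⟩, fun y hy => ?_, ?_⟩
    · refine le_trans (le_of_eq ?_) (hw _ (hψS hy))
      simp only [hψ, Complex.inner, Complex.mul_re, Complex.conj_re, Complex.conj_im]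
      field_simp
      simp [crossArea]
      ring
    · apply Complex.ext <;> simp [p, q] <;> field_simp <;> simp [hD, crossArea] <;> ring
  have hpfin := volume_polarBody_ne_top ho
  have himfin : volume (columnMap p q '' polarBody K) ≠ ⊤ := by
    rw [Measure.addHaar_image_linearMap]
    exact ENNReal.mul_ne_top ENNReal.ofReal_ne_top hpfin
  have hareaP : area (polarAt S (ψ 0)) ≤ |D| * area (polarBody K) := by
    unfold area
    rw [← hpq, ← toReal_volume_image_columnMap]
    exact ENNReal.toReal_mono himfin (measure_mono hsub)
  have hS0 : 0 ≤ area S := ENNReal.toReal_nonneg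
  have hsum (y : ℂ) : (ψ y).re + (ψ y).im = 1 - crossArea b c y / D := by
    simp only [hψ]
    field_simp
    simp [hD, crossArea]
    ring
  have key := normalized_cap_height_le hSconv (hSψ ▸ hcpt.image hψcont)
    (by simpa [hSdef, hφ] using hT.mem₁)
    (by
      have : φ 1 = b := by apply Complex.ext <;> simp [hφ]
      simpa [hSdef, this] using hT.mem₂)
    (by
      have : φ Complex.I = c := by apply Complex.ext <;> simp [hφ]
      simpa [hSdef, this] using hT.mem₃)
    (fun u hu v hv w hw => by
      have := hT.abs_le _ hu _ hv _ hw
      rw [crossArea_columnMap, hdet, abs_mul] at this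
      exact (le_abs_self _).trans (le_of_mul_le_mul_left (by linarith) hDabs))
    htS (ne_top_of_le_ne_top himfin (measure_mono hsub)) hε
    (by
      refine le_trans ?_ hvp
      rw [hareaK]
      calc _ ≤ area S * (|D| * area (polarBody K)) := by gcongr
        _ = _ := by ring)
    (hψS hx)
    (by
      intro z hz
      rw [hSψ] at hz
      obtain ⟨y, hy, rfl⟩ := hz
      rw [hsum, hsum]
      linarith [hxmin y hy])
    hle
  rw [hsum] at key
  linarith

/-- Every cap cut off by a maximal inscribed triangle is low. -/
lemma cap_bound {K : Set ℂ} (hconv : Convex ℝ K) (hcpt : IsCompact K)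
    (ho : (0 : ℂ) ∈ interior K) {a b c : ℂ} (hT : IsMaxTriangle K a b c) {ε : ℝ} (hε : 0 < ε)
    (hvp : area K * area (polarBody K) ≤ (1 + ε) * (27 / 4)) {y : ℂ} (hy : y ∈ K) :
    -(300 * ε) ≤ crossArea b c y / crossArea a b c := by
  obtain ⟨x, hx, hxmin⟩ := hcpt.exists_isMinOn ⟨y, hy⟩
    (f := fun y => crossArea b c y / crossArea a b c) (by unfold crossArea; fun_prop)
  replace hxmin : ∀ y ∈ K, crossArea b c x / crossArea a b c ≤ crossArea b c y / crossArea a b c :=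
    fun y hy => hxmin hy
  refine le_trans ?_ (hxmin y hy)
  rcases le_total (crossArea c a x / crossArea a b c) (crossArea a b x / crossArea a b c) with h | h
  · exact cap_bound_of_le hconv hcpt ho hT hε hvp hx hxmin h
  · have swap_div (u v w : ℂ) : crossArea v u w / crossArea a c b =
        crossArea u v w / crossArea a b c := by
      rw [crossArea_swap a b c, show crossArea v u w = -crossArea u v w by simp [crossArea]; ring,
        neg_div_neg_eq]
    rw [← swap_div]
    refine cap_bound_of_le hconv hcpt ho hT.swap hε hvp hx ?_ ?_
    · intro z hz
      rw [swap_div, swap_div]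
      exact hxmin z hz
    · rw [swap_div, swap_div]
      exact h

lemma crossArea_ne_zero_of_affineIndependent {a b c : ℂ} (h : AffineIndependent ℝ ![a, b, c]) :
    crossArea a b c ≠ 0 := by
  intro h0
  simp only [crossArea] at h0
  have hab : a ≠ b := h.injective.ne (a₁ := (0 : Fin 3)) (a₂ := 1) (by decide)
  rw [affineIndependent_iff] at h
  have hre := h Finset.univ ![b.re - c.re, c.re - a.re, a.re - b.re]
    (by simp [Fin.sum_univ_three])
    (by apply Complex.ext <;> simp [Fin.sum_univ_three] <;> linarith) 2 (Finset.mem_univ _)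
  have him := h Finset.univ ![b.im - c.im, c.im - a.im, a.im - b.im]
    (by simp [Fin.sum_univ_three])
    (by apply Complex.ext <;> simp [Fin.sum_univ_three] <;> linarith) 2 (Finset.mem_univ _)
  exact hab (Complex.ext (sub_eq_zero.1 hre) (sub_eq_zero.1 him))

lemma crossArea_sum_div {a b c : ℂ} (h : crossArea a b c ≠ 0) (y : ℂ) :
    crossArea b c y / crossArea a b c + crossArea c a y / crossArea a b c +
      crossArea a b y / crossArea a b c = 1 := by
  rw [← add_div, ← add_div, div_eq_one_iff_eq h]
  simp [crossArea]
  ring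

/-- The affine equivalence of the plane carrying one nondegenerate triangle to another one,
in barycentric coordinates. -/
lemma exists_affineEquiv {a b c a' b' c' : ℂ} (h : crossArea a b c ≠ 0)
    (h' : crossArea a' b' c' ≠ 0) : ∃ A : ℂ ≃ᵃ[ℝ] ℂ, ∀ y,
      A y = (crossArea b c y / crossArea a b c) • a' + (crossArea c a y / crossArea a b c) • b' +
        (crossArea a b y / crossArea a b c) • c' := by
  have frame {a b c : ℂ} (h : crossArea a b c ≠ 0) :
      ∃ F : ℂ ≃ᵃ[ℝ] ℂ, ∀ z, F z = a + columnMap (b - a) (c - a) z := by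
    have hd : LinearMap.det (columnMap (b - a) (c - a)) ≠ 0 := by
      rw [det_columnMap]
      simpa [crossArea] using h
    exact ⟨(LinearMap.equivOfDetNeZero _ hd).toAffineEquiv.trans (AffineEquiv.constVAdd ℝ ℂ a),
      fun z => rfl⟩
  obtain ⟨F, hF⟩ := frame h
  obtain ⟨G, hG⟩ := frame h'
  refine ⟨F.symm.trans G, fun y => ?_⟩
  obtain ⟨z, rfl⟩ := F.surjective y
  rw [AffineEquiv.trans_apply, F.symm_apply_apply, hG, hF]
  have e₁ : crossArea b c (a + columnMap (b - a) (c - a) z) =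
      (1 - z.re - z.im) * crossArea a b c := by
    simp [crossArea]; ring
  have e₂ : crossArea c a (a + columnMap (b - a) (c - a) z) = z.re * crossArea a b c := by
    simp [crossArea]; ring
  have e₃ : crossArea a b (a + columnMap (b - a) (c - a) z) = z.im * crossArea a b c := by
    simp [crossArea]; ring
  rw [e₁, e₂, e₃, mul_div_cancel_right₀ _ h, mul_div_cancel_right₀ _ h,
    mul_div_cancel_right₀ _ h]
  apply Complex.ext <;> simp <;> ring

/-- A convex set squeezed between a triangle and its outward parallel triangle
is close to every triangle. -/
lemma distBM_le_of_barycentric {K T : Set ℂ} (hconv : Convex ℝ K) (hT : IsTriangle T) {a b c : ℂ}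
    (ha : a ∈ K) (hb : b ∈ K) (hc : c ∈ K) (h : crossArea a b c ≠ 0) {δ : ℝ} (hδ : 0 ≤ δ)
    (h₁ : ∀ y ∈ K, -δ ≤ crossArea b c y / crossArea a b c)
    (h₂ : ∀ y ∈ K, -δ ≤ crossArea c a y / crossArea a b c)
    (h₃ : ∀ y ∈ K, -δ ≤ crossArea a b y / crossArea a b c) :
    distBM K T ≤ 1 + 3 * δ := by
  obtain ⟨u, v, w, hind, rfl⟩ := hT
  obtain ⟨A, hA⟩ := exists_affineEquiv h (crossArea_ne_zero_of_affineIndependent hind)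
  have hr : 0 < 1 + 3 * δ := by positivity
  refine csInf_le ⟨0, ?_⟩ ⟨1 / (1 + 3 * δ), 1,
    A.trans (AffineEquiv.constVAdd ℝ ℂ (δ • (u + v + w))), -(δ • (u + v + w)), by positivity,
    one_pos, by rw [one_div_one_div], ?_, ?_⟩
  · rintro _ ⟨l1, l2, -, -, h1, h2, rfl, -, -⟩
    positivity
  · rintro _ ⟨_, ⟨y, hy, rfl⟩, rfl⟩
    have hs := crossArea_sum_div h y
    have h₁ := h₁ y hy
    have h₂ := h₂ y hy
    have h₃ := h₃ y hy
    simp only [AffineEquiv.trans_apply, AffineEquiv.constVAdd_apply, hA, vadd_eq_add]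
    generalize crossArea b c y / crossArea a b c = α at *
    generalize crossArea c a y / crossArea a b c = β at *
    generalize crossArea a b y / crossArea a b c = γ at *
    have key := (convex_convexHull ℝ {u, v, w}).sum_mem (t := Finset.univ)
      (w := ![(α + δ) / (1 + 3 * δ), (β + δ) / (1 + 3 * δ), (γ + δ) / (1 + 3 * δ)])
      (z := ![u, v, w])
      (by
        intro i _
        fin_cases i
        exacts [div_nonneg (by linarith) hr.le, div_nonneg (by linarith) hr.le,
          div_nonneg (by linarith) hr.le])
      (by
        simp only [Fin.sum_univ_three, Matrix.cons_val]
        field_simp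
        linarith)
      (by
        intro i _
        apply subset_convexHull
        fin_cases i <;> simp)
    convert key using 1
    simp only [Fin.sum_univ_three, Matrix.cons_val]
    module
  · have hsub : convexHull ℝ {u, v, w} ⊆ A '' K := by
      refine convexHull_min ?_ (hconv.affine_image A.toAffineMap)
      have z₁ (x y : ℂ) : crossArea x y x = 0 := by simp [crossArea]
      have z₂ (x y : ℂ) : crossArea x y y = 0 := by unfold crossArea; ring
      have hu : A a = u := by
        have e : crossArea b c a = crossArea a b c := crossArea_rotate a b c
        rw [hA, e, div_self h]
        simp [z₁, z₂]
      have hv : A b = v := by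
        have e : crossArea c a b = crossArea a b c := by rw [crossArea_rotate, crossArea_rotate]
        rw [hA, e, div_self h]
        simp [z₁, z₂]
      have hw : A c = w := by
        rw [hA, div_self h]
        simp [z₁, z₂]
      rintro _ (rfl | rfl | rfl)
      exacts [⟨a, ha, hu⟩, ⟨b, hb, hv⟩, ⟨c, hc, hw⟩]
    intro t ht
    obtain ⟨y, hy, rfl⟩ := hsub ht
    exact ⟨_, ⟨_, ⟨y, hy, rfl⟩, rfl⟩, by simp; ring⟩

/-- Stability of the Mahler–Meyer inequality: if `o ∈ int K` and
`|K|·|K*| ≤ (1+ε)·27/4`, then the Banach–Mazur distance of `K` from any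
triangle `T` is at most `1 + 900ε`. -/
theorem mahler_meyer_stability (K T : Set ℂ) (hK : IsConvexBody K)
    (ho : (0 : ℂ) ∈ interior K) (hT : IsTriangle T) (ε : ℝ) (hε : 0 < ε)
    (hvp : area K * area (polarBody K) ≤ (1 + ε) * (27 / 4)) :
    distBM K T ≤ 1 + 900 * ε := by
  obtain ⟨a, b, c, hmax⟩ := exists_isMaxTriangle hK
  have h := distBM_le_of_barycentric hK.1 hT hmax.mem₁ hmax.mem₂ hmax.mem₃ hmax.ne_zero
    (δ := 300 * ε) (by positivity)
    (fun y hy => cap_bound hK.1 hK.2.1 ho hmax hε hvp hy)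
    (fun y hy => by
      simpa only [crossArea_rotate a b c] using
        cap_bound hK.1 hK.2.1 ho hmax.rotate hε hvp hy)
    (fun y hy => by
      simpa only [crossArea_rotate b c a, crossArea_rotate a b c] using
        cap_bound hK.1 hK.2.1 ho hmax.rotate.rotate hε hvp hy)
  linarith
end
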